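/- arXiv:1812.08969 — 2 statements merged into one kernel-verified Lean document; each statement's English description precedes it below -/
import Mathlib

section
/- Let X = {x_i} be a mild solution on [0,T] of the confined gradient-flow system ẋ_i(t) = P(x_i(t), F_i(X(t))) with F_i(X) := −∇_{x_i}E(X), and suppose X(t) ∈ G_* for all t. Then for almost every t ∈ (0,T): (d/dt)E(X(t)) ≤ 0; more precisely, (d/dt)E(X(t)) = Σ_{i=1}^n ( −|∇_{x_i}E(X(t))|² + χ_i(t)|∇_{x_i}E(X(t))·ν(x_i(t))|² ) ≤ 0, where χ_i(t) = 1 if x_i(t) ∈ ∂Ω and F_i(X(t))·ν(x_i(t)) > 0, and χ_i(t) = 0 otherwise. -/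
open Set MeasureTheory Filter
open scoped RealInnerProductSpace Topology NNReal ContDiff

noncomputable section

/-- Points of `ℝ^m`. -/
abbrev Pt (m : ℕ) := EuclideanSpace ℝ (Fin m)

/-- Configurations of `n` particles in `ℝ^m`, equipped with the sup-norm
`‖X‖ = max_i |x_i|`. -/
abbrev Conf (m n : ℕ) := Fin n → Pt m

variable {m n : ℕ}

open Classical in
/-- Signed distance function with respect to the boundary of `Ω`:
nonpositive on `cl Ω`, positive outside. -/
def sgnDist (Ω : Set (Pt m)) (x : Pt m) : ℝ :=
  if x ∈ closure Ω then -Metric.infDist x (frontier Ω) else Metric.infDist x (frontier Ω)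

/-- `Ω ⊆ ℝ^m` is a nonempty bounded open domain with `C²` boundary and outward
unit normal field `ν`: the signed distance function is `C²` near each boundary
point, and its gradient on the boundary is the outward unit normal `ν`. -/
structure IsC2Domain (Ω : Set (Pt m)) (ν : Pt m → Pt m) : Prop where
  isOpen : IsOpen Ω
  nonempty : Ω.Nonempty
  bounded : Bornology.IsBounded Ω
  smoothBoundary : ∀ x ∈ frontier Ω, ContDiffAt ℝ 2 (sgnDist Ω) x
  grad_eq_normal : ∀ x ∈ frontier Ω, gradient (sgnDist Ω) x = ν x
  normal_unit : ∀ x ∈ frontier Ω, ‖ν x‖ = 1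

open Classical in
/-- The one-sided projection `P(x,f)`: if `x ∈ ∂Ω` and `f · ν(x) > 0` then
`P(x,f) = f - (f·ν(x)) ν(x)`, otherwise `P(x,f) = f`. -/
def oneProj (Ω : Set (Pt m)) (ν : Pt m → Pt m) (x f : Pt m) : Pt m :=
  if x ∈ frontier Ω ∧ 0 < ⟪f, ν x⟫ then f - ⟪f, ν x⟫ • ν x else f

/-- The set `G = (cl Ω)^n` of admissible configurations. -/
def Gset (Ω : Set (Pt m)) (n : ℕ) : Set (Conf m n) := {X | ∀ i, X i ∈ closure Ω}

/-- Mild solution of the confined particle system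
`ẋ_i = H_i(t, X) = P(x_i, F_i(t,X))` on `[0,T]` with initial condition `X0`:
each `x_i` is continuous, stays in `cl Ω` and satisfies
`x_i(t) = x_i(0) + ∫₀ᵗ H_i(s, X(s)) ds`. -/
def IsMildSol (Ω : Set (Pt m)) (ν : Pt m → Pt m) (F : Fin n → ℝ → Conf m n → Pt m)
    (T : ℝ) (X0 : Conf m n) (X : ℝ → Conf m n) : Prop :=
  (∀ i, ContinuousOn (fun t => X t i) (Icc 0 T)) ∧
  (∀ t ∈ Icc (0:ℝ) T, ∀ i, X t i ∈ closure Ω) ∧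
  (∀ t ∈ Icc (0:ℝ) T, ∀ i,
    X t i = X0 i + ∫ s in (0:ℝ)..t, oneProj Ω ν (X s i) (F i s (X s)))

/-- The distance function `d(x) = dist(x, cl Ω)`. -/
def distCl (Ω : Set (Pt m)) (x : Pt m) : ℝ := Metric.infDist x (closure Ω)

open Classical in
/-- The function `d ∇d`, extended by `0` on `cl Ω`. -/
def dGradd (Ω : Set (Pt m)) (x : Pt m) : Pt m :=
  if x ∈ closure Ω then 0 else distCl Ω x • gradient (distCl Ω) x

/-- Classical solution of the penalized system
`ẋ_i(t) = F_i(t, X(t)) - k (d∇d)(x_i(t))` on `[0,T]`. -/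
def IsPenalSol (Ω : Set (Pt m)) (F : Fin n → ℝ → Conf m n → Pt m)
    (T k : ℝ) (X0 : Conf m n) (X : ℝ → Conf m n) : Prop :=
  X 0 = X0 ∧
  ∀ i, ∀ t ∈ Icc (0:ℝ) T,
    HasDerivWithinAt (fun s => X s i) (F i t (X t) - k • dGradd Ω (X t i)) (Icc 0 T) t

/-- Admissible configurations with pairwise distinct particle positions. -/
def Gstar (Ω : Set (Pt m)) (n : ℕ) : Set (Conf m n) :=
  {X | (∀ i, X i ∈ closure Ω) ∧ ∀ i j, i ≠ j → X i ≠ X j}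

/-- The particle interaction energy
`E(X) = (1/(n(n-1))) Σ_{j<i} V(x_i - x_j) + (1/n) Σ_i W(x_i)`. -/
def energy (V W : Pt m → ℝ) (X : Conf m n) : ℝ :=
  (1 / ((n : ℝ) * ((n : ℝ) - 1))) *
      ∑ i : Fin n, ∑ j ∈ Finset.filter (fun j => j < i) Finset.univ, V (X i - X j) +
    (1 / (n : ℝ)) * ∑ i : Fin n, W (X i)

/-- The gradient `∇_{x_i} E(X)` of the energy with respect to particle `i`. -/
def Egrad (V W : Pt m → ℝ) (i : Fin n) (X : Conf m n) : Pt m :=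
  gradient (fun y => energy V W (Function.update X i y)) (X i)

lemma aux_energy_contDiffAt (Ω : Set (Pt m)) (V : Pt m → ℝ) (hV : ContDiffOn ℝ 2 V {(0:Pt m)}ᶜ)
    (W : Pt m → ℝ) (hW : ∀ x ∈ closure Ω, ContDiffAt ℝ 2 W x) (Y : Conf m n)
    (hY : Y ∈ Gstar Ω n) : ContDiffAt ℝ 2 (energy V W : Conf m n → ℝ) Y := by
  unfold energy
  refine ContDiffAt.add (contDiffAt_const.mul ?_) (contDiffAt_const.mul ?_)
  · refine ContDiffAt.sum fun i _ => ContDiffAt.sum fun j hj => ?_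
    have hne : Y i - Y j ≠ 0 := by
      have hji : j < i := by simpa using hj
      exact sub_ne_zero.2 (hY.2 i j hji.ne')
    have h1 : ContDiffAt ℝ 2 V (Y i - Y j) :=
      hV.contDiffAt (isOpen_compl_singleton.mem_nhds hne)
    have h2 : ContDiffAt ℝ 2 (fun Z : Conf m n => Z i - Z j) Y := by fun_prop
    exact ContDiffAt.comp (g := V) Y h1 h2
  · refine ContDiffAt.sum fun i _ => ?_
    have h2 : ContDiffAt ℝ 2 (fun Z : Conf m n => Z i) Y := by fun_prop
    exact ContDiffAt.comp (g := W) Y (hW _ (hY.1 i)) h2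

lemma aux_Egrad_eq (V W : Pt m → ℝ) (i : Fin n) (Y : Conf m n)
    (hY : DifferentiableAt ℝ (energy V W : Conf m n → ℝ) Y) :
    Egrad V W i Y = (InnerProductSpace.toDual ℝ (Pt m)).symm
      ((fderiv ℝ (energy V W : Conf m n → ℝ) Y).comp
        (ContinuousLinearMap.pi (Pi.single i (.id ℝ (Pt m))))) := by
  unfold Egrad gradient
  congr 1
  have h1 : HasFDerivAt (energy V W : Conf m n → ℝ) (fderiv ℝ (energy V W : Conf m n → ℝ) Y)
      (Function.update Y i (Y i)) := by
    rw [Function.update_eq_self]; exact hY.hasFDerivAt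
  exact (h1.comp (Y i) (hasFDerivAt_update (𝕜 := ℝ) Y (Y i))).fderiv

lemma aux_inner_Egrad (V W : Pt m → ℝ) (i : Fin n) (Y : Conf m n)
    (hY : DifferentiableAt ℝ (energy V W : Conf m n → ℝ) Y) (v : Pt m) :
    ⟪Egrad V W i Y, v⟫ = fderiv ℝ (energy V W : Conf m n → ℝ) Y (Pi.single i v) := by
  rw [aux_Egrad_eq V W i Y hY, InnerProductSpace.toDual_symm_apply]
  simp only [ContinuousLinearMap.comp_apply]
  congr 1
  ext j : 1
  rcases eq_or_ne j i with rfl | h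
  · simp
  · simp [h]

lemma aux_fderiv_eq_sum (V W : Pt m → ℝ) (Y : Conf m n)
    (hY : DifferentiableAt ℝ (energy V W : Conf m n → ℝ) Y) (v : Conf m n) :
    fderiv ℝ (energy V W : Conf m n → ℝ) Y v = ∑ i, ⟪Egrad V W i Y, v i⟫ := by
  simp only [aux_inner_Egrad V W _ Y hY]
  rw [← map_sum, Finset.univ_sum_single]

lemma aux_Egrad_cont (Ω : Set (Pt m)) (V : Pt m → ℝ) (hV : ContDiffOn ℝ 2 V {(0:Pt m)}ᶜ)
    (W : Pt m → ℝ) (hW : ∀ x ∈ closure Ω, ContDiffAt ℝ 2 W x) (i : Fin n) :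
    ContinuousOn (fun Y : Conf m n => Egrad V W i Y) (Gstar Ω n) := by
  have h : ContinuousOn (fun Y : Conf m n => (InnerProductSpace.toDual ℝ (Pt m)).symm
      ((fderiv ℝ (energy V W : Conf m n → ℝ) Y).comp
        (ContinuousLinearMap.pi (Pi.single i (.id ℝ (Pt m)))))) (Gstar Ω n) := by
    intro Y hY
    have h1 := ((aux_energy_contDiffAt Ω V hV W hW Y hY).fderiv_right
      (m := 1) (by norm_num)).continuousAt
    have h2 := h1.clm_comp (continuousAt_const
      (y := (ContinuousLinearMap.pi (Pi.single i (.id ℝ (Pt m))) : Pt m →L[ℝ] Conf m n)))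
    exact ((InnerProductSpace.toDual ℝ (Pt m)).symm.continuous.continuousAt.comp
      h2).continuousWithinAt
  refine h.congr fun Y hY => ?_
  exact aux_Egrad_eq V W i Y
    ((aux_energy_contDiffAt Ω V hV W hW Y hY).differentiableAt (by norm_num))

lemma aux_nu_cont (Ω : Set (Pt m)) (ν : Pt m → Pt m) (hΩ : IsC2Domain Ω ν) :
    ContinuousOn ν (frontier Ω) := by
  have h : ContinuousOn (gradient (sgnDist Ω)) (frontier Ω) := by
    intro x hx
    have h1 := ((hΩ.smoothBoundary x hx).fderiv_right (m := 1) (by norm_num)).continuousAt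
    exact ((InnerProductSpace.toDual ℝ (Pt m)).symm.continuous.continuousAt.comp
      h1).continuousWithinAt
  exact h.congr fun x hx => (hΩ.grad_eq_normal x hx).symm

lemma aux_oneProj_inner (Ω : Set (Pt m)) (ν : Pt m → Pt m) (hΩ : IsC2Domain Ω ν) (x f : Pt m) :
    ‖oneProj Ω ν x f‖ ≤ 2 * ‖f‖ := by
  unfold oneProj
  split_ifs with h
  · have h1 := hΩ.normal_unit x h.1
    have h2 := abs_real_inner_le_norm f (ν x)
    have h3 := norm_sub_le f (⟪f, ν x⟫ • ν x)
    rw [norm_smul, h1, Real.norm_eq_abs] at h3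
    rw [h1] at h2
    linarith
  · linarith [norm_nonneg f]

lemma aux_oneProj_integrable (Ω : Set (Pt m)) (ν : Pt m → Pt m) (hΩ : IsC2Domain Ω ν) (T : ℝ)
    (x f : ℝ → Pt m) (hx : ContinuousOn x (Icc 0 T)) (hf : ContinuousOn f (Icc 0 T)) :
    IntegrableOn (fun s => oneProj Ω ν (x s) (f s)) (Icc 0 T) := by
  obtain ⟨C, hC⟩ := isCompact_Icc.exists_bound_of_continuousOn hf
  refine IntegrableOn.of_bound (by simp) ?_ (2 * C) ?_
  · have hBc : IsClosed (Icc 0 T ∩ x ⁻¹' frontier Ω) :=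
      hx.preimage_isClosed_of_isClosed isClosed_Icc isClosed_frontier
    have hsplit : Icc 0 T = (Icc 0 T ∩ x ⁻¹' frontier Ω) ∪ (Icc 0 T \ (Icc 0 T ∩ x ⁻¹' frontier Ω)) :=
      (union_sdiff_cancel inter_subset_left).symm
    rw [hsplit, aestronglyMeasurable_union_iff]
    constructor
    · refine ContinuousOn.aestronglyMeasurable ?_ hBc.measurableSet
      have hf' := hf.mono (inter_subset_left : Icc 0 T ∩ x ⁻¹' frontier Ω ⊆ _)
      have hν : ContinuousOn (fun s => ν (x s)) (Icc 0 T ∩ x ⁻¹' frontier Ω) :=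
        (aux_nu_cont Ω ν hΩ).comp (hx.mono inter_subset_left) fun s hs => hs.2
      have hq : ContinuousOn (fun s => f s - (max ⟪f s, ν (x s)⟫ 0) • ν (x s))
          (Icc 0 T ∩ x ⁻¹' frontier Ω) := by
        have hm : ContinuousOn (fun s => max ⟪f s, ν (x s)⟫ 0) (Icc 0 T ∩ x ⁻¹' frontier Ω) :=
          (ContinuousOn.inner (𝕜 := ℝ) hf' hν).sup continuousOn_const
        exact hf'.sub (hm.smul hν)
      refine hq.congr fun s hs => ?_
      have hs2 : x s ∈ frontier Ω := hs.2
      by_cases h : 0 < ⟪f s, ν (x s)⟫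
      · simp [oneProj, hs2, h, max_eq_left h.le]
      · simp [oneProj, h, max_eq_right (not_lt.1 h)]
    · refine ContinuousOn.aestronglyMeasurable ?_ (measurableSet_Icc.diff hBc.measurableSet)
      refine (hf.mono sdiff_subset).congr fun s hs => ?_
      have : x s ∉ frontier Ω := fun h => hs.2 ⟨hs.1, h⟩
      simp [oneProj, this]
  · filter_upwards [ae_restrict_mem measurableSet_Icc] with s hs
    exact (aux_oneProj_inner Ω ν hΩ _ _).trans (by linarith [hC s hs])

open Classical in
lemma aux_inner_oneProj (Ω : Set (Pt m)) (ν : Pt m → Pt m) (x g : Pt m) :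
    ⟪g, oneProj Ω ν x (-g)⟫ = -(‖g‖ ^ 2) +
      (if x ∈ frontier Ω ∧ 0 < ⟪-g, ν x⟫ then ⟪g, ν x⟫ ^ 2 else 0) := by
  unfold oneProj
  split_ifs with h
  · rw [inner_sub_right, inner_neg_right, inner_smul_right, inner_neg_left,
      real_inner_self_eq_norm_sq]
    ring
  · rw [inner_neg_right, real_inner_self_eq_norm_sq]; ring

open Classical in
/-- **Proposition (energy decay along the confined gradient flow).**
For a.e. `t ∈ (0,T)`,
`(d/dt)E(X(t)) = Σ_i (−|∇_iE|² + χ_i |∇_iE·ν(x_i)|²) ≤ 0`. -/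
theorem energy_decay {m n : ℕ} (Ω : Set (Pt m)) (ν : Pt m → Pt m)
    (hΩ : IsC2Domain Ω ν) (hn : 2 ≤ n)
    (V : Pt m → ℝ) (hV : ContDiffOn ℝ 2 V {(0:Pt m)}ᶜ)
    (hVtop : Tendsto V (𝓝[≠] (0:Pt m)) atTop)
    (hVsym : ∀ x : Pt m, x ≠ 0 → V (-x) = V x)
    (hVpos : ∀ x : Pt m, x ≠ 0 → 0 < V x)
    (W : Pt m → ℝ) (hW : ∀ x ∈ closure Ω, ContDiffAt ℝ 2 W x)
    (hW0 : ∀ x ∈ closure Ω, 0 ≤ W x)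
    (T : ℝ) (hT : 0 < T) (X0 : Conf m n) (hX0 : X0 ∈ Gstar Ω n)
    (X : ℝ → Conf m n)
    (hX : IsMildSol Ω ν (fun i _ Y => -Egrad V W i Y) T X0 X)
    (hXstar : ∀ t ∈ Icc (0:ℝ) T, X t ∈ Gstar Ω n) :
    ∀ᵐ t ∂(volume.restrict (Ioo 0 T)),
      HasDerivWithinAt (fun s => energy V W (X s))
        (∑ i : Fin n, (-(‖Egrad V W i (X t)‖ ^ 2) +
          (if X t i ∈ frontier Ω ∧ 0 < ⟪-Egrad V W i (X t), ν (X t i)⟫ then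
            ⟪Egrad V W i (X t), ν (X t i)⟫ ^ 2 else 0)))
        (Icc 0 T) t ∧
      (∑ i : Fin n, (-(‖Egrad V W i (X t)‖ ^ 2) +
        (if X t i ∈ frontier Ω ∧ 0 < ⟪-Egrad V W i (X t), ν (X t i)⟫ then
          ⟪Egrad V W i (X t), ν (X t i)⟫ ^ 2 else 0))) ≤ 0 := by
  obtain ⟨hXc, _, hXint⟩ := hX
  have hXcont : ContinuousOn X (Icc 0 T) := continuousOn_pi.2 hXc
  have hint : ∀ i, IntervalIntegrable
      (fun s => oneProj Ω ν (X s i) (-Egrad V W i (X s))) volume 0 T := by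
    intro i
    rw [intervalIntegrable_iff_integrableOn_Icc_of_le hT.le]
    exact aux_oneProj_integrable Ω ν hΩ T (fun s => X s i) (fun s => -Egrad V W i (X s))
      (hXc i) (((aux_Egrad_cont Ω V hV W hW i).comp hXcont hXstar).neg)
  have hae := ae_all_iff.2 fun i => (hint i).ae_hasDerivAt_integral
  rw [ae_restrict_iff' measurableSet_Ioo]
  filter_upwards [hae] with t ht htI
  have htI' : t ∈ Icc 0 T := Ioo_subset_Icc_self htI
  have hdiff : DifferentiableAt ℝ (energy V W : Conf m n → ℝ) (X t) :=
    (aux_energy_contDiffAt Ω V hV W hW (X t) (hXstar t htI')).differentiableAt (by norm_num)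
  constructor
  · have hd : HasDerivWithinAt X (fun i => oneProj Ω ν (X t i) (-Egrad V W i (X t)))
        (Icc 0 T) t := by
      rw [hasDerivWithinAt_pi]
      intro i
      have h1 := ht i (by rwa [uIcc_of_le hT.le]) 0 (by simp)
      exact ((h1.const_add (X0 i)).hasDerivWithinAt).congr (fun s hs => hXint s hs i)
        (hXint t htI' i)
    have h2 := hdiff.hasFDerivAt.comp_hasDerivWithinAt t hd
    rw [aux_fderiv_eq_sum V W (X t) hdiff] at h2
    simp only [aux_inner_oneProj] at h2
    exact h2
  · refine Finset.sum_nonpos fun i _ => ?_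
    split_ifs with h
    · have h1 := hΩ.normal_unit _ h.1
      have h2 := abs_real_inner_le_norm (Egrad V W i (X t)) (ν (X t i))
      rw [h1, mul_one] at h2
      have h3 := sq_le_sq' (abs_le.1 h2).1 (abs_le.1 h2).2
      linarith
    · nlinarith [sq_nonneg ‖Egrad V W i (X t)‖]
end
end

section
/- For every T > 0 and every initial condition X° ∈ G_*, the confined gradient-flow system ẋ_i(t) = P(x_i(t), F_i(X(t))) with F_i(X) := −∇_{x_i}E(X), x_i(0) = x_i°, possesses a unique mild solution X on [0,T]; in particular X(t) ∈ G_* for all t ∈ [0,T], even though the forces F_i blow up as two particles approach each other. -/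
open Set MeasureTheory Filter
open scoped RealInnerProductSpace Topology NNReal ContDiff

noncomputable section

variable {m n : ℕ}

/-- Smooth saturation function. -/
def satFn (r s : ℝ) : ℝ :=
  s * (1 - Real.smoothTransition (s / r - 1)) + 2 * r * Real.smoothTransition (s / r - 1)

lemma satFn_of_le {r s : ℝ} (hr : 0 < r) (h : s ≤ r) : satFn r s = s := by
  have : Real.smoothTransition (s / r - 1) = 0 := by
    apply Real.smoothTransition.zero_of_nonpos
    have := (div_le_one hr).2 h
    linarith
  simp [satFn, this]

lemma satFn_of_ge {r s : ℝ} (hr : 0 < r) (h : 2 * r ≤ s) : satFn r s = 2 * r := by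
  have : Real.smoothTransition (s / r - 1) = 1 := by
    apply Real.smoothTransition.one_of_one_le
    have := (le_div_iff₀ hr).2 h
    linarith
  simp [satFn, this]

lemma le_satFn {r s : ℝ} (hr : 0 < r) (h : r ≤ s) : r ≤ satFn r s := by
  have h0 := Real.smoothTransition.nonneg (s / r - 1)
  have h1 := Real.smoothTransition.le_one (s / r - 1)
  unfold satFn
  nlinarith [mul_nonneg (sub_nonneg.2 h) (sub_nonneg.2 h1)]

lemma contDiff_satFn (r : ℝ) : ContDiff ℝ 2 (satFn r) := by
  unfold satFn
  have : ContDiff ℝ 2 (fun s : ℝ => Real.smoothTransition (s / r - 1)) :=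
    Real.smoothTransition.contDiff.comp (by fun_prop)
  fun_prop

/-- Two-sided smooth saturation. -/
def satTwo (r s : ℝ) : ℝ := - satFn r (- satFn r s)

lemma contDiff_satTwo (r : ℝ) : ContDiff ℝ 2 (satTwo r) :=
  ((contDiff_satFn r).comp (contDiff_satFn r).neg).neg

lemma satTwo_of_abs_le {r s : ℝ} (hr : 0 < r) (h : |s| ≤ r) : satTwo r s = s := by
  obtain ⟨h1, h2⟩ := abs_le.1 h
  unfold satTwo
  rw [satFn_of_le hr h2, satFn_of_le hr (by linarith)]; ring

lemma satTwo_of_ge {r s : ℝ} (hr : 0 < r) (h : 2 * r ≤ s) : satTwo r s = 2 * r := by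
  unfold satTwo
  rw [satFn_of_ge hr h, satFn_of_le hr (by linarith)]; ring

lemma satTwo_of_le {r s : ℝ} (hr : 0 < r) (h : s ≤ - (2 * r)) : satTwo r s = - (2 * r) := by
  unfold satTwo
  rw [satFn_of_le (s := s) hr (by linarith), satFn_of_ge hr (by linarith)]

lemma le_satTwo {r s : ℝ} (hr : 0 < r) (h : r ≤ s) : r ≤ satTwo r s := by
  unfold satTwo
  have := le_satFn hr h
  rw [satFn_of_le (s := - satFn r s) hr (by linarith)]; linarith

lemma satTwo_pos {r s : ℝ} (hr : 0 < r) (h : 0 < s) : 0 < satTwo r s := by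
  rcases le_total s r with h1 | h1
  · rw [satTwo_of_abs_le hr (abs_le.2 ⟨by linarith, h1⟩)]; exact h
  · exact hr.trans_le (le_satTwo hr h1)

lemma satTwo_neg {r s : ℝ} (hr : 0 < r) (h : s < 0) : satTwo r s < 0 := by
  unfold satTwo
  rw [satFn_of_le (s := s) hr (by linarith)]
  rcases le_total (-s) r with h1 | h1
  · rw [satFn_of_le hr h1]; linarith
  · have := le_satFn hr h1; linarith

lemma continuous_sgnDist (Ω : Set (Pt m)) : Continuous (sgnDist Ω) := by
  unfold sgnDist
  classical
  refine Continuous.if ?_ ?_ ?_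
  · intro a ha
    have ha : a ∈ frontier Ω := frontier_closure_subset ha
    simp [Metric.infDist_zero_of_mem ha]
  · exact (Metric.continuous_infDist_pt _).neg
  · exact Metric.continuous_infDist_pt _

lemma abs_sgnDist (Ω : Set (Pt m)) (x : Pt m) :
    |sgnDist Ω x| = Metric.infDist x (frontier Ω) := by
  unfold sgnDist
  split_ifs <;> simp [abs_of_nonneg Metric.infDist_nonneg]

/-- Properties of a global `C²` defining function of the domain. -/
structure GoodG (Ω : Set (Pt m)) (ν : Pt m → Pt m) (G : Pt m → ℝ) : Prop where
  diff : Differentiable ℝ G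
  lip : ∃ K : ℝ≥0, LipschitzWith K (gradient G)
  lipG : ∃ K : ℝ≥0, LipschitzWith K G
  bddGrad : ∃ C : ℝ, ∀ x, ‖gradient G x‖ ≤ C
  bdd : ∃ C : ℝ, ∀ x, |G x| ≤ C
  neg : ∀ x ∈ Ω, G x < 0
  zero : ∀ x ∈ frontier Ω, G x = 0
  pos : ∀ x, x ∉ closure Ω → 0 < G x
  grad : ∀ x ∈ frontier Ω, gradient G x = ν x
  nondeg : ∃ ε > 0, ∀ x, 0 < G x → G x ≤ ε → 1 / 2 ≤ ‖gradient G x‖ ^ 2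

lemma exists_goodG [Nontrivial (Pt m)] {Ω : Set (Pt m)} {ν : Pt m → Pt m}
    (hΩ : IsC2Domain Ω ν) : ∃ G, GoodG Ω ν G := by
  have hcl : IsCompact (closure Ω) := hΩ.bounded.isCompact_closure
  have hfr : IsCompact (frontier Ω) := hcl.of_isClosed_subset isClosed_frontier frontier_subset_closure
  have hne : (frontier Ω).Nonempty := by
    rw [nonempty_frontier_iff]
    refine ⟨hΩ.nonempty, ?_⟩
    rintro rfl
    have : NoncompactSpace (Pt m) := NormedSpace.noncompactSpace ℝ _
    exact noncompact_univ (Pt m) (by simpa using hcl)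
  obtain ⟨r', hr', hsub⟩ := hfr.exists_thickening_subset_open
    (t := {x | ContDiffAt ℝ 2 (sgnDist Ω) x})
    (by
      rw [isOpen_iff_mem_nhds]
      intro x hx
      exact ContDiffAt.eventually hx (by simp)) hΩ.smoothBoundary
  obtain ⟨r, hr, rfl⟩ : ∃ r : ℝ, 0 < r ∧ r' = 3 * r := ⟨r' / 3, by positivity, by ring⟩
  set s := sgnDist Ω with hs
  have hsc : Continuous s := continuous_sgnDist Ω
  set G : Pt m → ℝ := fun x => satTwo r (s x) with hG
  have hGC : ContDiff ℝ 2 G := by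
    rw [contDiff_iff_contDiffAt]
    intro x
    rcases lt_or_ge (|s x|) (3 * r) with h | h
    · have : ContDiffAt ℝ 2 s x := by
        apply hsub
        rw [Metric.mem_thickening_iff_infDist_lt hne]
        rwa [hs, abs_sgnDist] at h
      exact (contDiff_satTwo r).contDiffAt.comp x this
    · rcases le_abs.1 h with h | h
      · have : G =ᶠ[𝓝 x] fun _ => 2 * r := by
          filter_upwards [hsc.continuousAt.eventually (lt_mem_nhds (show 2 * r < s x by linarith))]
            with y hy
          exact satTwo_of_ge hr hy.le
        exact contDiffAt_const.congr_of_eventuallyEq this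
      · have : G =ᶠ[𝓝 x] fun _ => - (2 * r) := by
          filter_upwards [hsc.continuousAt.eventually (gt_mem_nhds (show s x < -(2 * r) by linarith))]
            with y hy
          exact satTwo_of_le hr hy.le
        exact contDiffAt_const.congr_of_eventuallyEq this
  have hcs : HasCompactSupport (fun x => G x - 2 * r) := by
    refine HasCompactSupport.intro (K := Metric.cthickening (2 * r) (closure Ω))
      hcl.cthickening ?_
    intro x hx
    have hx1 : x ∉ closure Ω := fun h => hx (Metric.self_subset_cthickening _ h)
    have : 2 * r ≤ s x := by
      by_contra hlt
      push Not at hlt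
      rw [hs, sgnDist, if_neg hx1] at hlt
      obtain ⟨y, hy, hxy⟩ := (Metric.infDist_lt_iff hne).1 hlt
      exact hx (Metric.mem_cthickening_of_dist_le x y _ _ (frontier_subset_closure hy) hxy.le)
    simp [hG, satTwo_of_ge hr this]
  have hfd : ∀ x, fderiv ℝ (fun x => G x - 2 * r) x = fderiv ℝ G x := fun x =>
    fderiv_sub_const (2 * r)
  have hcs' : HasCompactSupport (fderiv ℝ G) := by
    have := hcs.fderiv ℝ
    rwa [funext hfd] at this
  have hGd : Differentiable ℝ G := hGC.differentiable (by simp)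
  have hf1 : ContDiff ℝ 1 (fderiv ℝ G) := hGC.fderiv_right (by norm_num)
  obtain ⟨K, hK⟩ := hf1.lipschitzWith_of_hasCompactSupport hcs' (by simp)
  obtain ⟨C, hC⟩ := hcs'.exists_bound_of_continuous hf1.continuous
  obtain ⟨C', hC'⟩ := hcs.exists_bound_of_continuous (by have := hGd.continuous; fun_prop)
  obtain ⟨K', hK'⟩ := (hGC.sub contDiff_const : ContDiff ℝ 2 (fun x => G x - 2 * r)).lipschitzWith_of_hasCompactSupport hcs (by simp)
  have hgl : LipschitzWith K (gradient G) := by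
    refine LipschitzWith.of_dist_le_mul fun x y => ?_
    rw [gradient, gradient, LinearIsometryEquiv.dist_map]
    exact hK.dist_le_mul x y
  have hgr : ∀ x ∈ frontier Ω, gradient G x = ν x := by
    intro x hx
    rw [← hΩ.grad_eq_normal x hx]
    have hx0 : |s x| < r := by
      rw [hs, abs_sgnDist, Metric.infDist_zero_of_mem hx]; exact hr
    have : G =ᶠ[𝓝 x] s := by
      filter_upwards [hsc.abs.continuousAt.eventually (gt_mem_nhds hx0)] with y hy
      exact satTwo_of_abs_le hr hy.le
    simp only [gradient, this.fderiv_eq, hs]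
  refine ⟨G, hGd, ⟨K, hgl⟩, ⟨K', ?_⟩, ⟨C, ?_⟩, ⟨C' + |2 * r|, ?_⟩, ?_, ?_, ?_, hgr, ?_⟩
  · refine LipschitzWith.of_dist_le_mul fun x y => ?_
    have := hK'.dist_le_mul x y
    simpa using this
  · intro x
    rw [gradient, LinearIsometryEquiv.norm_map]
    exact hC x
  · intro x
    have h1 := hC' x
    rw [Real.norm_eq_abs] at h1
    have := abs_add_le (G x - 2 * r) (2 * r)
    rw [sub_add_cancel] at this
    linarith
  · intro x hx
    apply satTwo_neg hr
    rw [hs, sgnDist, if_pos (subset_closure hx)]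
    have : x ∉ frontier Ω := by
      rw [hΩ.isOpen.frontier_eq]; exact fun h => h.2 hx
    have := (isClosed_frontier.notMem_iff_infDist_pos hne).1 this
    linarith
  · intro x hx
    have h0 : s x = 0 := by
      rw [← abs_eq_zero, hs, abs_sgnDist, Metric.infDist_zero_of_mem hx]
    simp only [hG, h0]
    exact satTwo_of_abs_le hr (by simpa using hr.le)
  · intro x hx
    apply satTwo_pos hr
    rw [hs, sgnDist, if_neg hx]
    exact (isClosed_frontier.notMem_iff_infDist_pos hne).1 fun h => hx (frontier_subset_closure h)
  · obtain ⟨δ, hδ, hsub2⟩ := hfr.exists_thickening_subset_open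
      (t := {x | 1 / 2 < ‖gradient G x‖ ^ 2})
      (isOpen_lt continuous_const (hgl.continuous.norm.pow 2))
      (fun x hx => by
        simp only [mem_ofPred_eq, hgr x hx, hΩ.normal_unit x hx]; norm_num)
    refine ⟨min r δ / 2, by positivity, fun x hx0 hx1 => ?_⟩
    have hm1 := min_le_left r δ
    have hm2 := min_le_right r δ
    have hs1 : s x < r := by
      by_contra h
      push Not at h
      have := le_satTwo hr h
      simp only [hG] at hx1
      linarith
    have hs0 : 0 < s x := by
      by_contra h
      push Not at h
      rcases h.lt_or_eq with h | h
      · have := satTwo_neg hr h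
        simp only [hG] at hx0; linarith
      · simp only [hG, h] at hx0
        rw [satTwo_of_abs_le hr (by simpa using hr.le)] at hx0
        exact lt_irrefl _ hx0
    have hGs : G x = s x := satTwo_of_abs_le hr (abs_le.2 ⟨by linarith, hs1.le⟩)
    have : x ∈ Metric.thickening δ (frontier Ω) := by
      rw [Metric.mem_thickening_iff_infDist_lt hne, ← abs_sgnDist, ← hs, abs_of_pos hs0]
      have : 0 < min r δ := lt_min hr hδ
      linarith
    exact (hsub2 this).le
lemma inner_grad_eq {f : Pt m → ℝ} {x v : Pt m} : ⟪gradient f x, v⟫ = fderiv ℝ f x v := by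
  simp [gradient]

lemma GoodG.quad {Ω : Set (Pt m)} {ν : Pt m → Pt m} {G : Pt m → ℝ} (hG : GoodG Ω ν G) :
    ∃ K : ℝ, 0 ≤ K ∧ ∀ x y, ⟪gradient G x, y - x⟫ ≤ G y - G x + K * ‖y - x‖ ^ 2 := by
  obtain ⟨K, hK⟩ := hG.lip
  refine ⟨K, K.2, fun x y => ?_⟩
  have := Convex.norm_image_sub_le_of_norm_fderiv_le' (𝕜 := ℝ) (f := G) (φ := fderiv ℝ G x)
    (C := K * ‖y - x‖) (s := segment ℝ x y) (x := x) (y := y)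
    (fun z _ => hG.diff z) (fun z hz => by
      have h1 := hK.dist_le_mul z x
      rw [gradient, gradient, LinearIsometryEquiv.dist_map, dist_eq_norm, dist_eq_norm] at h1
      refine h1.trans ?_
      gcongr
      exact norm_sub_le_of_mem_segment hz) (convex_segment x y) (left_mem_segment ℝ x y)
      (right_mem_segment ℝ x y)
  rw [inner_grad_eq]
  rw [Real.norm_eq_abs] at this
  have := (abs_le.1 this).1
  nlinarith

lemma GoodG.le_zero {Ω : Set (Pt m)} {ν : Pt m → Pt m} {G : Pt m → ℝ} (hG : GoodG Ω ν G)
    (ho : IsOpen Ω) {x : Pt m} (hx : x ∈ closure Ω) : G x ≤ 0 := by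
  by_cases h : x ∈ Ω
  · exact (hG.neg x h).le
  · exact (hG.zero x (by rw [ho.frontier_eq]; exact ⟨hx, h⟩)).le

lemma oneProj_eq {Ω : Set (Pt m)} {ν : Pt m → Pt m} {G : Pt m → ℝ} (hG : GoodG Ω ν G)
    (x f : Pt m) : oneProj Ω ν x f
      = f - ((frontier Ω).indicator (fun x => max ⟪f, gradient G x⟫ 0) x) • gradient G x := by
  classical
  unfold oneProj
  by_cases hx : x ∈ frontier Ω
  · rw [indicator_of_mem hx, hG.grad x hx]
    split_ifs with h
    · rw [max_eq_left h.2.le]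
    · rw [max_eq_right (not_lt.1 fun h' => h ⟨hx, h'⟩)]; simp
  · rw [indicator_of_notMem hx, if_neg (fun h => hx h.1)]; simp

lemma oneProj_decomp {Ω : Set (Pt m)} {ν : Pt m → Pt m} {G : Pt m → ℝ} (hG : GoodG Ω ν G)
    (hν : ∀ x ∈ frontier Ω, ‖ν x‖ = 1) (x f : Pt m) :
    ∃ c : ℝ, 0 ≤ c ∧ c ≤ ‖f‖ ∧ oneProj Ω ν x f = f - c • gradient G x ∧ (c ≠ 0 → x ∈ frontier Ω) := by
  refine ⟨_, ?_, ?_, oneProj_eq hG x f, ?_⟩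
  · exact indicator_nonneg (fun _ _ => le_max_right _ _) _
  · by_cases hx : x ∈ frontier Ω
    · rw [indicator_of_mem hx, hG.grad x hx]
      refine max_le ?_ (norm_nonneg _)
      have := real_inner_le_norm f (ν x)
      rwa [hν x hx, mul_one] at this
    · rw [indicator_of_notMem hx]; exact norm_nonneg _
  · intro h
    by_contra hx
    exact h (indicator_of_notMem hx _)

lemma inner_oneProj {Ω : Set (Pt m)} {ν : Pt m → Pt m}
    (hν : ∀ x ∈ frontier Ω, ‖ν x‖ = 1) (x f : Pt m) :
    ⟪f, oneProj Ω ν x f⟫ = ‖oneProj Ω ν x f‖ ^ 2 := by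
  classical
  unfold oneProj
  split_ifs with h
  · have h1 := hν x h.1
    rw [← real_inner_self_eq_norm_sq]
    simp only [inner_sub_left, inner_sub_right, real_inner_smul_left, real_inner_smul_right,
      real_inner_self_eq_norm_sq, real_inner_comm f (ν x), norm_smul, mul_pow, h1,
      Real.norm_eq_abs, sq_abs]
    ring
  · exact real_inner_self_eq_norm_sq f

lemma norm_oneProj_le {Ω : Set (Pt m)} {ν : Pt m → Pt m}
    (hν : ∀ x ∈ frontier Ω, ‖ν x‖ = 1) (x f : Pt m) :
    ‖oneProj Ω ν x f‖ ≤ ‖f‖ := by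
  have h1 := inner_oneProj hν x f
  have h2 := real_inner_le_norm f (oneProj Ω ν x f)
  by_contra h
  push Not at h
  nlinarith [norm_nonneg f, norm_nonneg (oneProj Ω ν x f)]

/-- A Lipschitz function whose derivative is a.e. nonpositive does not exceed its initial value. -/
lemma le_of_ae_deriv_nonpos {f : ℝ → ℝ} {T : ℝ} {K : ℝ≥0}
    (hf : LipschitzOnWith K f (Icc 0 T))
    (hd : ∀ᵐ t, t ∈ Ioo (0:ℝ) T → ∃ d ≤ 0, HasDerivAt f d t) :
    ∀ t ∈ Icc (0:ℝ) T, f t ≤ f 0 := by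
  intro t ht
  have hac : AbsolutelyContinuousOnInterval f 0 t := by
    apply LipschitzOnWith.absolutelyContinuousOnInterval (K := K)
    rw [uIcc_of_le ht.1]
    exact hf.mono (Icc_subset_Icc_right ht.2)
  have h1 := hac.integral_deriv_eq_sub
  have h2 : ∫ x in (0:ℝ)..t, deriv f x ≤ 0 := by
    rw [intervalIntegral.integral_of_le ht.1, integral_Ioc_eq_integral_Ioo]
    apply integral_nonpos_of_ae
    rw [EventuallyLE, ae_restrict_iff' measurableSet_Ioo]
    filter_upwards [hd] with x hx hxt
    obtain ⟨d, hd0, hd⟩ := hx ⟨hxt.1, hxt.2.trans_le ht.2⟩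
    rw [hd.deriv]; exact hd0
  linarith

/-- FTC for Lipschitz functions with values in a finite dimensional space. -/
lemma eq_integral_of_ae_deriv {f p : ℝ → Pt m} {T M : ℝ} {K : ℝ≥0} (hT : 0 ≤ T)
    (hf : LipschitzOnWith K f (Icc 0 T)) (hM : ∀ t, ‖p t‖ ≤ M)
    (hp : IntervalIntegrable p volume 0 T)
    (hd : ∀ᵐ t, t ∈ Ioo (0:ℝ) T → HasDerivAt f (p t) t) :
    ∀ t ∈ Icc (0:ℝ) T, f t = f 0 + ∫ s in (0:ℝ)..t, p s := by
  have hpi : ∀ t ∈ Icc (0:ℝ) T, IntervalIntegrable p volume 0 t := fun t ht =>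
    hp.mono_set (by rw [uIcc_of_le ht.1, uIcc_of_le hT]; exact Icc_subset_Icc_right ht.2)
  have hlp : LipschitzOnWith ⟨M, (norm_nonneg _).trans (hM 0)⟩ (fun t => ∫ s in (0:ℝ)..t, p s) (Icc 0 T) := by
    refine LipschitzOnWith.of_dist_le_mul fun x hx y hy => ?_
    rw [dist_eq_norm, intervalIntegral.integral_interval_sub_left (hpi x hx) (hpi y hy)]
    refine (intervalIntegral.norm_integral_le_of_norm_le_const (C := M) (fun t _ => hM t)).trans ?_
    rw [Real.dist_eq]; rfl
  have hac : AbsolutelyContinuousOnInterval (fun t => f t - ∫ s in (0:ℝ)..t, p s) 0 T := by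
    apply LipschitzOnWith.absolutelyContinuousOnInterval (K := K + ⟨M, (norm_nonneg _).trans (hM 0)⟩)
    rw [uIcc_of_le hT]
    exact hf.sub hlp
  obtain ⟨C, hC⟩ := hac.const_of_ae_hasDerivAt_zero (by
    have h0 : ∀ᵐ t : ℝ, t ≠ 0 := by simp [ae_iff]
    have h1 : ∀ᵐ t : ℝ, t ≠ T := by simp [ae_iff]
    filter_upwards [hd, hp.ae_hasDerivAt_integral, h0, h1] with t h2 h3 h4 h5 ht
    have ht' := ht
    rw [uIcc_of_le hT] at ht'
    have := (h2 ⟨lt_of_le_of_ne ht'.1 h4.symm, lt_of_le_of_ne ht'.2 h5⟩).sub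
      (h3 ht 0 (by simp))
    rw [sub_self] at this
    exact this)
  rw [uIcc_of_le hT] at hC
  intro t ht
  have h1 := hC t ht
  have h2 := hC 0 ⟨le_rfl, hT⟩
  simp only [intervalIntegral.integral_same, sub_zero] at h2
  rw [h2, ← h1]; abel

/-- Almost-everywhere formulation of the projected system. -/
structure AESol (Ω : Set (Pt m)) (ν : Pt m → Pt m) (F : Conf m n → Conf m n)
    (T : ℝ) (X0 : Conf m n) (X : ℝ → Conf m n) : Prop where
  lip : ∃ K : ℝ≥0, LipschitzOnWith K X (Icc 0 T)
  mem : ∀ t ∈ Icc (0:ℝ) T, ∀ i, X t i ∈ closure Ω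
  init : X 0 = X0
  deriv : ∀ᵐ t, t ∈ Ioo (0:ℝ) T → ∀ i,
    HasDerivAt (fun s => X s i) (oneProj Ω ν (X t i) (F (X t) i)) t

lemma intervalIntegrable_proj {Ω : Set (Pt m)} {ν : Pt m → Pt m} {G : Pt m → ℝ}
    (hG : GoodG Ω ν G) (hν : ∀ x ∈ frontier Ω, ‖ν x‖ = 1)
    {F : Conf m n → Conf m n} (hF : Continuous F) {M : ℝ} (hM : ∀ X, ‖F X‖ ≤ M)
    {T : ℝ} (hT : 0 ≤ T) {X : ℝ → Conf m n} (hX : ContinuousOn X (Icc 0 T)) (i : Fin n) :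
    IntervalIntegrable (fun s => oneProj Ω ν (X s i) (F (X s) i)) volume 0 T := by
  obtain ⟨Kg, hKg⟩ := hG.lip
  have hgc := hKg.continuous
  have hq : Measurable (fun Z : Conf m n => oneProj Ω ν (Z i) (F Z i)) := by
    have : (fun Z : Conf m n => oneProj Ω ν (Z i) (F Z i)) = fun Z : Conf m n =>
        F Z i - (((fun Z : Conf m n => Z i) ⁻¹' frontier Ω).indicator
          (fun Z => max ⟪F Z i, gradient G (Z i)⟫ 0) Z) • gradient G (Z i) := by
      ext1 Z
      rw [oneProj_eq hG]
      rfl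
    rw [this]
    have hFi : Continuous fun Z => F Z i := (continuous_apply i).comp hF
    have hgi : Continuous fun Z : Conf m n => gradient G (Z i) := hgc.comp (continuous_apply i)
    refine hFi.measurable.sub (Measurable.fun_smul ?_ hgi.measurable)
    refine Measurable.indicator ?_ ?_
    · exact ((hFi.inner hgi).max continuous_const).measurable
    · exact (isClosed_frontier.preimage (continuous_apply i)).measurableSet
  rw [intervalIntegrable_iff_integrableOn_Icc_of_le hT]
  refine Integrable.of_bound (C := M) ?_ ?_
  · exact (hq.comp_aemeasurable (hX.aemeasurable measurableSet_Icc)).aestronglyMeasurable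
  · refine ae_of_all _ fun s => ?_
    exact (norm_oneProj_le hν _ _).trans ((norm_le_pi_norm _ i).trans (hM _))

lemma AESol.isMildSol {Ω : Set (Pt m)} {ν : Pt m → Pt m} {G : Pt m → ℝ}
    (hG : GoodG Ω ν G) (hν : ∀ x ∈ frontier Ω, ‖ν x‖ = 1)
    {F : Conf m n → Conf m n} (hF : Continuous F) {M : ℝ} (hM : ∀ X, ‖F X‖ ≤ M)
    {T : ℝ} (hT : 0 ≤ T) {X0 : Conf m n} {X : ℝ → Conf m n} (h : AESol Ω ν F T X0 X) :
    IsMildSol Ω ν (fun i _ Y => F Y i) T X0 X := by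
  obtain ⟨K, hK⟩ := h.lip
  refine ⟨fun i => (continuous_apply i).comp_continuousOn hK.continuousOn, h.mem, fun t ht i => ?_⟩
  rw [← h.init]
  refine eq_integral_of_ae_deriv (f := fun t => X t i) (K := K) (M := M) hT ?_ ?_
    (intervalIntegrable_proj hG hν hF hM hT hK.continuousOn i) ?_ t ht
  · refine LipschitzOnWith.of_dist_le_mul fun x hx y hy => ?_
    exact (dist_le_pi_dist _ _ i).trans (hK.dist_le_mul x hx y hy)
  · exact fun s => (norm_oneProj_le hν _ _).trans ((norm_le_pi_norm _ i).trans (hM _))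
  · filter_upwards [h.deriv] with t h1 h2 using h1 h2 i

lemma aeSol_of_isMildSol {Ω : Set (Pt m)} {ν : Pt m → Pt m} {G : Pt m → ℝ}
    (hG : GoodG Ω ν G) (hν : ∀ x ∈ frontier Ω, ‖ν x‖ = 1)
    {F : Conf m n → Conf m n} (hF : Continuous F) {M : ℝ} (hM : ∀ X, ‖F X‖ ≤ M)
    {T : ℝ} (hT : 0 ≤ T) {X0 : Conf m n} {X : ℝ → Conf m n}
    (h : IsMildSol Ω ν (fun i _ Y => F Y i) T X0 X) : AESol Ω ν F T X0 X := by
  obtain ⟨hc, hm, he⟩ := h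
  have hM0 : 0 ≤ M := (norm_nonneg _).trans (hM X0)
  have hX : ContinuousOn X (Icc 0 T) := continuousOn_pi.2 hc
  have hI := fun i => intervalIntegrable_proj hG hν hF hM hT hX i
  have hIt : ∀ i, ∀ t ∈ Icc (0:ℝ) T, IntervalIntegrable
      (fun s => oneProj Ω ν (X s i) (F (X s) i)) volume 0 t := fun i t ht =>
    (hI i).mono_set (by rw [uIcc_of_le ht.1, uIcc_of_le hT]; exact Icc_subset_Icc_right ht.2)
  refine ⟨⟨⟨M, hM0⟩, ?_⟩, hm, ?_, ?_⟩
  · refine LipschitzOnWith.of_dist_le_mul fun x hx y hy => ?_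
    refine (dist_pi_le_iff (by positivity)).2 fun i => ?_
    rw [he x hx i, he y hy i, dist_add_left, dist_eq_norm,
      intervalIntegral.integral_interval_sub_left (hIt i x hx) (hIt i y hy)]
    refine (intervalIntegral.norm_integral_le_of_norm_le_const (C := M) (fun t _ => ?_)).trans ?_
    · exact (norm_oneProj_le hν _ _).trans ((norm_le_pi_norm _ i).trans (hM _))
    · rw [Real.dist_eq]; rfl
  · ext1 i
    rw [he 0 ⟨le_rfl, hT⟩ i]; simp
  · have hd := fun i => (hI i).ae_hasDerivAt_integral
    rw [← ae_all_iff] at hd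
    filter_upwards [hd] with t h1 ht i
    have h2 := (h1 i (by rw [uIcc_of_le hT]; exact Ioo_subset_Icc_self ht) 0 (by simp)).const_add (X0 i)
    refine h2.congr_of_eventuallyEq ?_
    filter_upwards [Icc_mem_nhds ht.1 ht.2] with s hs
    exact he s hs i
/-- Sum of squared distances. -/
def sqD (X Y : Conf m n) : ℝ := ∑ i, ‖X i - Y i‖ ^ 2

lemma sqD_nonneg (X Y : Conf m n) : 0 ≤ sqD X Y := Finset.sum_nonneg fun _ _ => by positivity

lemma norm_sq_le_sqD (X Y : Conf m n) : ‖X - Y‖ ^ 2 ≤ sqD X Y := by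
  have : ‖X - Y‖ ≤ √(sqD X Y) := by
    refine (pi_norm_le_iff_of_nonneg (Real.sqrt_nonneg _)).2 fun i => ?_
    apply Real.le_sqrt_of_sq_le
    exact Finset.single_le_sum (f := fun i => ‖X i - Y i‖ ^ 2) (fun _ _ => by positivity)
      (Finset.mem_univ i)
  calc ‖X - Y‖ ^ 2 ≤ √(sqD X Y) ^ 2 := by gcongr
    _ = _ := Real.sq_sqrt (sqD_nonneg X Y)

lemma force_le {F : Conf m n → Conf m n} {L : ℝ≥0} (hF : LipschitzWith L F) (X Y : Conf m n) :
    ∑ i, ⟪X i - Y i, F X i - F Y i⟫ ≤ n * L * sqD X Y := by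
  have h : ∀ i ∈ Finset.univ, ⟪X i - Y i, F X i - F Y i⟫ ≤ L * sqD X Y := by
    intro i _
    have h1 := real_inner_le_norm (X i - Y i) (F X i - F Y i)
    have h2 : ‖X i - Y i‖ ≤ ‖X - Y‖ := norm_le_pi_norm (X - Y) i
    have h3 : ‖F X i - F Y i‖ ≤ L * ‖X - Y‖ := by
      refine (norm_le_pi_norm (F X - F Y) i).trans ?_
      rw [← dist_eq_norm, ← dist_eq_norm]
      exact hF.dist_le_mul X Y
    calc _ ≤ ‖X i - Y i‖ * ‖F X i - F Y i‖ := h1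
      _ ≤ ‖X - Y‖ * (L * ‖X - Y‖) := by gcongr
      _ = L * ‖X - Y‖ ^ 2 := by ring
      _ ≤ _ := by gcongr; exact norm_sq_le_sqD X Y
  refine (Finset.sum_le_sum h).trans ?_
  simp [mul_assoc]

lemma lip_comp {E : Type*} [NormedAddCommGroup E] [NormedSpace ℝ E] [FiniteDimensional ℝ E]
    {Φ : E → ℝ} (hΦ : ContDiff ℝ 1 Φ) {γ : ℝ → E} {T : ℝ} {K : ℝ≥0}
    (hγ : LipschitzOnWith K γ (Icc 0 T)) : ∃ K', LipschitzOnWith K' (fun t => Φ (γ t)) (Icc 0 T) := by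
  have hb : Bornology.IsBounded (γ '' Icc 0 T) := (isCompact_Icc.image_of_continuousOn hγ.continuousOn).isBounded
  obtain ⟨R, hR⟩ := hb.subset_closedBall 0
  obtain ⟨C, hC⟩ := hΦ.contDiffOn.exists_lipschitzOnWith (s := Metric.closedBall (0:E) R) (by simp)
    (convex_closedBall _ _) (isCompact_closedBall _ _)
  exact ⟨C * K, hC.comp hγ (fun t ht => hR (mem_image_of_mem _ ht))⟩

lemma hypomonotone {Ω : Set (Pt m)} {ν : Pt m → Pt m} {G : Pt m → ℝ} (hΩ : IsOpen Ω)
    (hG : GoodG Ω ν G) (hν : ∀ x ∈ frontier Ω, ‖ν x‖ = 1) {K : ℝ} (hK0 : 0 ≤ K)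
    (hK : ∀ x y, ⟪gradient G x, y - x⟫ ≤ G y - G x + K * ‖y - x‖ ^ 2)
    {M : ℝ} {x y f g : Pt m} (hx : x ∈ closure Ω) (hy : y ∈ closure Ω) (hf : ‖f‖ ≤ M) (hg : ‖g‖ ≤ M) :
    ⟪x - y, oneProj Ω ν x f - oneProj Ω ν y g⟫ ≤ ⟪x - y, f - g⟫ + 2 * M * K * ‖x - y‖ ^ 2 := by
  have key : ∀ x y f : Pt m, y ∈ closure Ω → ‖f‖ ≤ M →
      ⟪x - y, oneProj Ω ν x f⟫ ≤ ⟪x - y, f⟫ + M * K * ‖x - y‖ ^ 2 := by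
    intro x y f hy hf
    obtain ⟨c, hc0, hc1, he, hc⟩ := oneProj_decomp hG hν x f
    have h1 : ⟪x - y, c • gradient G x⟫ = - (c * ⟪gradient G x, y - x⟫) := by
      rw [← neg_sub y x, inner_neg_left, real_inner_smul_right, real_inner_comm]
    rw [he, inner_sub_right, h1, norm_sub_rev x y]
    have h2 : c * ⟪gradient G x, y - x⟫ ≤ c * (K * ‖y - x‖ ^ 2) := by
      by_cases h0 : c = 0
      · simp [h0]
      · have h3 := hK x y
        rw [hG.zero x (hc h0)] at h3
        have := hG.le_zero hΩ hy
        gcongr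
        linarith
    have h4 : c * (K * ‖y - x‖ ^ 2) ≤ M * (K * ‖y - x‖ ^ 2) := by
      gcongr; exact hc1.trans hf
    linarith
  have h1 := key x y f hy hf
  have h2 := key y x g hx hg
  rw [norm_sub_rev] at h2
  rw [← neg_sub x y, inner_neg_left, inner_neg_left] at h2
  rw [inner_sub_right, inner_sub_right]
  linarith

lemma AESol.unique {Ω : Set (Pt m)} {ν : Pt m → Pt m} {G : Pt m → ℝ} (hΩ : IsOpen Ω)
    (hG : GoodG Ω ν G) (hν : ∀ x ∈ frontier Ω, ‖ν x‖ = 1)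
    {F : Conf m n → Conf m n} {L : ℝ≥0} (hF : LipschitzWith L F) {M : ℝ} (hM : ∀ X, ‖F X‖ ≤ M)
    {T : ℝ} {X0 : Conf m n} {X Y : ℝ → Conf m n} (hX : AESol Ω ν F T X0 X)
    (hY : AESol Ω ν F T X0 Y) : ∀ t ∈ Icc (0:ℝ) T, Y t = X t := by
  obtain ⟨K, hK0, hK⟩ := hG.quad
  set A : ℝ := 2 * (n * L) + 4 * M * K with hA
  obtain ⟨K1, hK1⟩ := hX.lip
  obtain ⟨K2, hK2⟩ := hY.lip
  have hΦ : ContDiff ℝ 1 (fun p : ℝ × Conf m n × Conf m n =>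
      Real.exp (-A * p.1) * ∑ i, ‖p.2.1 i - p.2.2 i‖ ^ 2) := by
    refine ContDiff.mul (by fun_prop) (ContDiff.sum fun i _ => ContDiff.norm_sq ℝ ?_)
    fun_prop
  obtain ⟨K', hK'⟩ := lip_comp hΦ (LipschitzWith.id.lipschitzOnWith.prodMk (hK1.prodMk hK2))
  have h0 := le_of_ae_deriv_nonpos hK' (by
    filter_upwards [hX.deriv, hY.deriv] with t h1 h2 ht
    have ht' := Ioo_subset_Icc_self ht
    have hsum : HasDerivAt (fun s => sqD (X s) (Y s)) (∑ i, 2 * ⟪X t i - Y t i,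
        oneProj Ω ν (X t i) (F (X t) i) - oneProj Ω ν (Y t i) (F (Y t) i)⟫) t :=
      HasDerivAt.fun_sum fun i _ => ((h1 ht i).sub (h2 ht i)).norm_sq
    have hexp : HasDerivAt (fun s : ℝ => Real.exp (-A * s)) (Real.exp (-A * t) * -A) t := by
      simpa using ((hasDerivAt_id t).const_mul (-A)).exp
    refine ⟨_, ?_, hexp.mul hsum⟩
    have hle : ∑ i, 2 * ⟪X t i - Y t i,
        oneProj Ω ν (X t i) (F (X t) i) - oneProj Ω ν (Y t i) (F (Y t) i)⟫ ≤ A * sqD (X t) (Y t) := by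
      calc _ ≤ ∑ i, (2 * ⟪X t i - Y t i, F (X t) i - F (Y t) i⟫ + 4 * M * K * ‖X t i - Y t i‖ ^ 2) := by
            refine Finset.sum_le_sum fun i _ => ?_
            have := hypomonotone hΩ hG hν hK0 hK (hX.mem t ht' i) (hY.mem t ht' i)
              ((norm_le_pi_norm _ i).trans (hM (X t))) ((norm_le_pi_norm _ i).trans (hM (Y t)))
            linarith
        _ = 2 * ∑ i, ⟪X t i - Y t i, F (X t) i - F (Y t) i⟫ + 4 * M * K * sqD (X t) (Y t) := by
            rw [Finset.sum_add_distrib, ← Finset.mul_sum, ← Finset.mul_sum]; rfl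
        _ ≤ _ := by
            have := force_le hF (X t) (Y t)
            rw [hA]; linarith
    have := mul_nonneg (Real.exp_pos (-A * t)).le (sub_nonneg.2 hle)
    unfold sqD at this
    linarith)
  intro t ht
  have h1 := h0 t ht
  simp only [id, hX.init, hY.init, sub_self, norm_zero] at h1
  have h2 : ∑ i, ‖X t i - Y t i‖ ^ 2 ≤ 0 := by
    by_contra h
    push Not at h
    have := mul_pos (Real.exp_pos (-A * t)) h
    simp at h1 this
    linarith
  have h3 := norm_sq_le_sqD (X t) (Y t)
  have h4 : ‖X t - Y t‖ ^ 2 ≤ 0 := h3.trans h2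
  have h5 : ‖X t - Y t‖ = 0 := by
    have := sq_nonneg ‖X t - Y t‖
    exact pow_eq_zero_iff (two_ne_zero) |>.1 (le_antisymm h4 this)
  exact (sub_eq_zero.1 (norm_eq_zero.1 h5)).symm
/-- Penalized vector field. -/
def penF (F : Conf m n → Conf m n) (G : Pt m → ℝ) (k : ℝ) (X : Conf m n) : Conf m n :=
  fun i => F X i - (k * max (G (X i)) 0) • gradient G (X i)

lemma lip_smul_bdd {E : Type*} [PseudoMetricSpace E] {a : E → ℝ} {b : E → Pt m} {Ka Kb : ℝ≥0} {Ca Cb : ℝ}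
    (ha : LipschitzWith Ka a) (hb : LipschitzWith Kb b) (hCa : ∀ x, |a x| ≤ Ca)
    (hCb : ∀ x, ‖b x‖ ≤ Cb) : ∃ K : ℝ≥0, LipschitzWith K (fun x => a x • b x) := by
  rcases isEmpty_or_nonempty E with h | ⟨⟨x0⟩⟩
  · exact ⟨0, fun x => (h.false x).elim⟩
  have hCa0 : 0 ≤ Ca := (abs_nonneg _).trans (hCa x0)
  have hCb0 : 0 ≤ Cb := (norm_nonneg _).trans (hCb x0)
  refine ⟨⟨Ca * Kb + Ka * Cb, by positivity⟩, LipschitzWith.of_dist_le_mul fun x y => ?_⟩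
  have h1 := ha.dist_le_mul x y
  have h2 := hb.dist_le_mul x y
  rw [Real.dist_eq] at h1
  rw [dist_eq_norm] at h2
  have : a x • b x - a y • b y = a x • (b x - b y) + (a x - a y) • b y := by
    rw [smul_sub, sub_smul]; abel
  rw [dist_eq_norm, this]
  calc _ ≤ |a x| * ‖b x - b y‖ + |a x - a y| * ‖b y‖ := by
        refine (norm_add_le _ _).trans ?_
        rw [norm_smul, norm_smul]; rfl
    _ ≤ Ca * (Kb * dist x y) + (Ka * dist x y) * Cb := by
        gcongr
        · exact hCa x
        · exact hCb y
    _ = (Ca * Kb + Ka * Cb) * dist x y := by ring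

lemma penF_lip {Ω : Set (Pt m)} {ν : Pt m → Pt m} {G : Pt m → ℝ} (hG : GoodG Ω ν G)
    {F : Conf m n → Conf m n} {L : ℝ≥0} (hF : LipschitzWith L F) {M : ℝ} (hM : ∀ X, ‖F X‖ ≤ M)
    {k : ℝ} (hk : 0 ≤ k) :
    ∃ (K C : ℝ≥0), LipschitzWith K (penF F G k) ∧ ∀ X, ‖penF F G k X‖ ≤ C := by
  obtain ⟨Kg, hKg⟩ := hG.lip
  obtain ⟨KG, hKG⟩ := hG.lipG
  obtain ⟨Cg, hCg⟩ := hG.bddGrad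
  obtain ⟨CG, hCG⟩ := hG.bdd
  have hCG0 : 0 ≤ CG := (abs_nonneg _).trans (hCG 0)
  have hCg0 : 0 ≤ Cg := (norm_nonneg _).trans (hCg 0)
  have hM0 : 0 ≤ M := (norm_nonneg _).trans (hM 0)
  have hmax : LipschitzWith KG (fun x => max (G x) 0) := hKG.max_const 0
  have hmaxb : ∀ x, |max (G x) 0| ≤ CG := fun x => by
    rw [abs_of_nonneg (le_max_right _ _)]
    exact max_le ((le_abs_self _).trans (hCG x)) hCG0
  obtain ⟨K, hK⟩ := lip_smul_bdd hmax hKg hmaxb hCg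
  refine ⟨L + Real.toNNReal k * K, ⟨M + k * CG * Cg, by positivity⟩, ?_, ?_⟩
  · refine LipschitzWith.of_dist_le_mul fun X Y => ?_
    refine (dist_pi_le_iff (by positivity)).2 fun i => ?_
    have h1 : dist (F X i) (F Y i) ≤ L * dist X Y :=
      (dist_le_pi_dist _ _ i).trans (hF.dist_le_mul X Y)
    have h2 : dist ((k * max (G (X i)) 0) • gradient G (X i))
        ((k * max (G (Y i)) 0) • gradient G (Y i)) ≤ k * (K * dist X Y) := by
      rw [mul_smul, mul_smul, dist_smul₀, Real.norm_of_nonneg hk]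
      gcongr
      refine (hK.dist_le_mul _ _).trans ?_
      gcongr
      exact dist_le_pi_dist _ _ i
    refine (dist_sub_sub_le _ _ _ _).trans ?_
    rw [NNReal.coe_add, NNReal.coe_mul, Real.coe_toNNReal k hk]
    linarith
  · intro X
    refine (pi_norm_le_iff_of_nonneg (NNReal.coe_nonneg _)).2 fun i => ?_
    refine (norm_sub_le _ _).trans ?_
    have h1 : ‖F X i‖ ≤ M := (norm_le_pi_norm _ i).trans (hM X)
    have h2 : ‖(k * max (G (X i)) 0) • gradient G (X i)‖ ≤ k * CG * Cg := by
      rw [norm_smul, Real.norm_eq_abs, abs_mul, abs_of_nonneg hk]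
      gcongr
      · exact hmaxb _
      · exact hCg _
    exact add_le_add h1 h2

lemma penF_exists {Ω : Set (Pt m)} {ν : Pt m → Pt m} {G : Pt m → ℝ} (hG : GoodG Ω ν G)
    {F : Conf m n → Conf m n} {L : ℝ≥0} (hF : LipschitzWith L F) {M : ℝ} (hM : ∀ X, ‖F X‖ ≤ M)
    {T : ℝ} (hT : 0 ≤ T) (X0 : Conf m n) {k : ℝ} (hk : 0 ≤ k) :
    ∃ X : ℝ → Conf m n, X 0 = X0 ∧
      ∀ t ∈ Icc (0:ℝ) T, HasDerivWithinAt X (penF F G k (X t)) (Icc 0 T) t := by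
  obtain ⟨K, C, hK, hC⟩ := penF_lip hG hF hM hk
  have h0 : (0:ℝ) ∈ Icc (0:ℝ) T := ⟨le_rfl, hT⟩
  have hP : IsPicardLindelof (fun _ => penF F G k) (tmin := 0) (tmax := T) ⟨0, h0⟩ X0
      (C * Real.toNNReal T) 0 C K :=
    IsPicardLindelof.of_time_independent (fun x _ => hC x) hK.lipschitzOnWith (by
      simp [hT, Real.coe_toNNReal T hT])
  exact hP.exists_eq_forall_mem_Icc_hasDerivWithinAt₀

lemma hasDerivWithinAt_Ici_of_Icc {E : Type*} [NormedAddCommGroup E] [NormedSpace ℝ E]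
    {f : ℝ → E} {f' : E} {T t : ℝ} (ht : t ∈ Ico 0 T) (h : HasDerivWithinAt f f' (Icc 0 T) t) :
    HasDerivWithinAt f f' (Ici t) t := by
  refine h.mono_of_mem_nhdsWithin ?_
  exact mem_of_superset (Icc_mem_nhdsGE ht.2) (Icc_subset_Icc_left ht.1)

/-- Uniform bound on the penalty multiplier. -/
lemma penF_bound {Ω : Set (Pt m)} {ν : Pt m → Pt m} {G : Pt m → ℝ} (hΩ : IsOpen Ω)
    (hG : GoodG Ω ν G)
    {F : Conf m n → Conf m n} {M : ℝ} (hM : ∀ X, ‖F X‖ ≤ M) (T : ℝ)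
    {X0 : Conf m n} (hX0 : ∀ i, X0 i ∈ closure Ω) :
    ∃ Λ : ℝ, 0 ≤ Λ ∧ ∃ k0 : ℝ, 0 < k0 ∧ ∀ k, k0 ≤ k → ∀ X : ℝ → Conf m n, X 0 = X0 →
      (∀ t ∈ Icc (0:ℝ) T, HasDerivWithinAt X (penF F G k (X t)) (Icc 0 T) t) →
      ∀ t ∈ Icc (0:ℝ) T, ∀ i, k * max (G (X t i)) 0 ≤ Λ := by
  obtain ⟨C, hC⟩ := hG.bddGrad
  obtain ⟨ε, hε, hnd⟩ := hG.nondeg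
  have hC0 : 0 ≤ C := (norm_nonneg _).trans (hC 0)
  have hM0 : 0 ≤ M := (norm_nonneg _).trans (hM 0)
  set D : ℝ := C * M + 1 with hD
  have hD0 : 0 < D := by positivity
  refine ⟨2 * D, by positivity, 2 * D / ε, by positivity, fun k hk X hX hd t ht i => ?_⟩
  have hk0 : 0 < k := lt_of_lt_of_le (by positivity) hk
  have hb : 2 * D / k ≤ ε := by
    rw [div_le_iff₀ hk0]; rw [div_le_iff₀ hε] at hk; linarith
  have hb0 : 0 < 2 * D / k := by positivity
  have hXi : ∀ t ∈ Icc (0:ℝ) T, HasDerivWithinAt (fun s => X s i) (penF F G k (X t) i) (Icc 0 T) t :=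
    fun t ht => (hasDerivWithinAt_pi.1 (hd t ht)) i
  have hGX : ∀ t ∈ Icc (0:ℝ) T, HasDerivWithinAt (fun s => G (X s i))
      (⟪gradient G (X t i), penF F G k (X t) i⟫) (Icc 0 T) t := fun t ht => by
    rw [inner_grad_eq]
    exact (hG.diff (X t i)).hasFDerivAt.comp_hasDerivWithinAt t (hXi t ht)
  have key := image_le_of_deriv_right_lt_deriv_boundary (f := fun s => G (X s i)) (a := 0) (b := T)
    (f' := fun t => ⟪gradient G (X t i), penF F G k (X t) i⟫) (B := fun _ => 2 * D / k) (B' := fun _ => 0)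
    (fun t ht => (hGX t ht).continuousWithinAt)
    (fun t ht => hasDerivWithinAt_Ici_of_Icc ht (hGX t (Ico_subset_Icc_self ht)))
    (by
      rw [hX]
      exact (hG.le_zero hΩ (hX0 i)).trans hb0.le)
    (fun x => hasDerivAt_const _ _)
    (by
      intro s hs heq
      have h1 := hnd (X s i) (heq ▸ hb0) (heq ▸ hb)
      have h2 : ⟪gradient G (X s i), F (X s) i⟫ ≤ C * M :=
        (real_inner_le_norm _ _).trans (mul_le_mul (hC _) ((norm_le_pi_norm _ i).trans (hM _))
          (norm_nonneg _) hC0)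
      have h3 : k * max (G (X s i)) 0 = 2 * D := by
        rw [heq, max_eq_left hb0.le]; field_simp
      simp only [penF]
      rw [h3, inner_sub_right, real_inner_smul_right, real_inner_self_eq_norm_sq]
      nlinarith)
  have h1 := key ht
  have h2 : max (G (X t i)) 0 ≤ 2 * D / k := max_le h1 hb0.le
  calc k * max (G (X t i)) 0 ≤ k * (2 * D / k) := by gcongr
    _ = 2 * D := by field_simp

/-- Cauchy estimate for the penalized solutions. -/
lemma penF_cauchy {Ω : Set (Pt m)} {ν : Pt m → Pt m} {G : Pt m → ℝ}
    (hG : GoodG Ω ν G)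
    {F : Conf m n → Conf m n} {L : ℝ≥0} (hF : LipschitzWith L F) (T : ℝ)
    {Λ : ℝ} (hΛ : 0 ≤ Λ) :
    ∃ C : ℝ, 0 ≤ C ∧ ∀ k l, 0 < k → 0 < l → ∀ X Y : ℝ → Conf m n, X 0 = Y 0 →
      (∀ t ∈ Icc (0:ℝ) T, HasDerivWithinAt X (penF F G k (X t)) (Icc 0 T) t) →
      (∀ t ∈ Icc (0:ℝ) T, HasDerivWithinAt Y (penF F G l (Y t)) (Icc 0 T) t) →
      (∀ t ∈ Icc (0:ℝ) T, ∀ i, k * max (G (X t i)) 0 ≤ Λ) →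
      (∀ t ∈ Icc (0:ℝ) T, ∀ i, l * max (G (Y t i)) 0 ≤ Λ) →
      ∀ t ∈ Icc (0:ℝ) T, ‖X t - Y t‖ ^ 2 ≤ C * (1 / k + 1 / l) := by
  obtain ⟨K, hK0, hK⟩ := hG.quad
  set A : ℝ := 2 * (n * L) + 4 * Λ * K + 1 with hA
  have hA0 : 0 < A := by positivity
  refine ⟨2 * n * Λ ^ 2 / A * Real.exp (A * T), by positivity, ?_⟩
  intro k l hk hl X Y h0 hX hY hbX hbY t ht
  have hu : ∀ t ∈ Icc (0:ℝ) T, HasDerivWithinAt (fun s => sqD (X s) (Y s))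
      (∑ i, 2 * ⟪X t i - Y t i, penF F G k (X t) i - penF F G l (Y t) i⟫) (Icc 0 T) t :=
    fun t ht => HasDerivWithinAt.fun_sum fun i _ =>
      (((hasDerivWithinAt_pi.1 (hX t ht)) i).sub ((hasDerivWithinAt_pi.1 (hY t ht)) i)).norm_sq
  have pt : ∀ k l : ℝ, 0 < k → 0 < l → ∀ x y : Pt m, k * max (G x) 0 ≤ Λ → l * max (G y) 0 ≤ Λ →
      k * max (G x) 0 * ⟪gradient G x, y - x⟫ ≤ Λ * (Λ * (1 / l) + K * ‖y - x‖ ^ 2) := by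
    intro k l hk hl x y hx hy
    have hy' : max (G y) 0 ≤ Λ * (1 / l) := by
      rw [mul_one_div, le_div_iff₀ hl]; linarith
    have hr : 0 ≤ Λ * (1 / l) + K * ‖y - x‖ ^ 2 := by positivity
    rcases le_or_gt (G x) 0 with h | h
    · rw [max_eq_right h]
      simp only [mul_zero, zero_mul]
      positivity
    · have h1 : ⟪gradient G x, y - x⟫ ≤ Λ * (1 / l) + K * ‖y - x‖ ^ 2 := by
        have := hK x y
        have := le_max_left (G y) 0
        linarith
      have h2 : 0 ≤ k * max (G x) 0 := by positivity
      calc _ ≤ k * max (G x) 0 * (Λ * (1 / l) + K * ‖y - x‖ ^ 2) := by gcongr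
        _ ≤ _ := by gcongr
  have hgr := le_gronwallBound_of_liminf_deriv_right_le (f := fun s => sqD (X s) (Y s)) (a := 0) (b := T)
    (f' := fun t => ∑ i, 2 * ⟪X t i - Y t i, penF F G k (X t) i - penF F G l (Y t) i⟫)
    (δ := 0) (K := A) (ε := 2 * n * Λ ^ 2 * (1 / k + 1 / l))
    (fun t ht => (hu t ht).continuousWithinAt)
    (fun t ht r hr => (hasDerivWithinAt_Ici_of_Icc ht (hu t (Ico_subset_Icc_self ht))).liminf_right_slope_le hr)
    (by simp [h0, sqD])
    (by
      intro s hs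
      have hs' := Ico_subset_Icc_self hs
      have hle : ∀ i ∈ Finset.univ, 2 * ⟪X s i - Y s i, penF F G k (X s) i - penF F G l (Y s) i⟫
          ≤ 2 * ⟪X s i - Y s i, F (X s) i - F (Y s) i⟫ + (2 * Λ ^ 2 * (1 / k + 1 / l)
            + 4 * Λ * K * ‖X s i - Y s i‖ ^ 2) := by
        intro i _
        have e1 := pt k l hk hl (X s i) (Y s i) (hbX s hs' i) (hbY s hs' i)
        have e2 := pt l k hl hk (Y s i) (X s i) (hbY s hs' i) (hbX s hs' i)
        rw [norm_sub_rev] at e1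
        have e3 : ⟪X s i - Y s i, penF F G k (X s) i - penF F G l (Y s) i⟫ =
            ⟪X s i - Y s i, F (X s) i - F (Y s) i⟫
            + k * max (G (X s i)) 0 * ⟪gradient G (X s i), Y s i - X s i⟫
            + l * max (G (Y s i)) 0 * ⟪gradient G (Y s i), X s i - Y s i⟫ := by
          simp only [penF, inner_sub_right, inner_sub_left, real_inner_smul_right,
            real_inner_comm (X s i) (gradient G _), real_inner_comm (Y s i) (gradient G _)]
          ring
        rw [e3]
        nlinarith
      refine (Finset.sum_le_sum hle).trans ?_
      rw [Finset.sum_add_distrib, Finset.sum_add_distrib, ← Finset.mul_sum]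
      have h1 := force_le hF (X s) (Y s)
      have h2 := sqD_nonneg (X s) (Y s)
      have h3 : ∑ i, 4 * Λ * K * ‖X s i - Y s i‖ ^ 2 = 4 * Λ * K * sqD (X s) (Y s) := by
        rw [sqD, Finset.mul_sum]
      rw [h3]
      simp only [Finset.sum_const, Finset.card_univ, Fintype.card_fin, nsmul_eq_mul]
      rw [hA]
      nlinarith) t ht
  refine (norm_sq_le_sqD _ _).trans (hgr.trans ?_)
  rw [gronwallBound_of_K_ne_0 hA0.ne']
  simp only [zero_mul, zero_add, sub_zero]
  have h1 : Real.exp (A * t) ≤ Real.exp (A * T) := by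
    apply Real.exp_le_exp.2
    have := ht.2
    gcongr
  have h2 : 0 ≤ 2 * n * Λ ^ 2 * (1 / k + 1 / l) / A := by positivity
  calc _ ≤ 2 * n * Λ ^ 2 * (1 / k + 1 / l) / A * Real.exp (A * T) := by
        gcongr; linarith
    _ = _ := by ring

/-- Local estimate on penalized drift. -/
lemma pen_local {Ω : Set (Pt m)} {ν : Pt m → Pt m} {G : Pt m → ℝ} (hG : GoodG Ω ν G)
    {F : Conf m n → Conf m n} (hF : Continuous F) {Λ : ℝ} (hΛ : 0 ≤ Λ) (Z0 : Conf m n) (i : Fin n)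
    (v : Pt m) (hv : G (Z0 i) < 0 ∨ 0 ≤ ⟪gradient G (Z0 i), v⟫) {ε : ℝ} (hε : 0 < ε) :
    ∃ δ > 0, ∀ Z, dist Z Z0 < δ → ∀ k, 0 < k → k * max (G (Z i)) 0 ≤ Λ →
      ⟪penF F G k Z i, v⟫ ≤ ⟪F Z0 i, v⟫ + ε := by
  obtain ⟨K, hK⟩ := hG.lip
  have c1 : Continuous fun Z : Conf m n => ⟪F Z i, v⟫ := by fun_prop
  have hGc : Continuous G := hG.diff.continuous
  have hgc : Continuous (gradient G) := hK.continuous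
  have c2 : Continuous fun Z : Conf m n => ⟪gradient G (Z i), v⟫ := by fun_prop
  have c3 : Continuous fun Z : Conf m n => G (Z i) := by fun_prop
  have e1 : ∀ᶠ Z in 𝓝 Z0, ⟪F Z i, v⟫ < ⟪F Z0 i, v⟫ + ε / 2 :=
    c1.continuousAt.eventually_lt continuousAt_const (by linarith)
  rcases hv with hv | hv
  · have e2 : ∀ᶠ Z in 𝓝 Z0, G (Z i) < 0 :=
      c3.continuousAt.eventually_lt continuousAt_const hv
    obtain ⟨δ, hδ, h⟩ := Metric.eventually_nhds_iff.1 (e1.and e2)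
    refine ⟨δ, hδ, fun Z hZ k hk _ => ?_⟩
    obtain ⟨h1, h2⟩ := h hZ
    simp only [penF]
    rw [max_eq_right h2.le, mul_zero, zero_smul, sub_zero]
    linarith
  · have e2 : ∀ᶠ Z in 𝓝 Z0, -(ε / (2 * (Λ + 1))) < ⟪gradient G (Z i), v⟫ :=
      continuousAt_const.eventually_lt c2.continuousAt
        (lt_of_lt_of_le (neg_lt_zero.2 (by positivity)) hv)
    obtain ⟨δ, hδ, h⟩ := Metric.eventually_nhds_iff.1 (e1.and e2)
    refine ⟨δ, hδ, fun Z hZ k hk hkΛ => ?_⟩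
    obtain ⟨h1, h2⟩ := h hZ
    simp only [penF]
    rw [inner_sub_left, real_inner_smul_left]
    have h0 : 0 ≤ k * max (G (Z i)) 0 := by positivity
    have h3 : k * max (G (Z i)) 0 * (-⟪gradient G (Z i), v⟫)
        ≤ Λ * (ε / (2 * (Λ + 1))) := by
      have : k * max (G (Z i)) 0 * (-⟪gradient G (Z i), v⟫)
          ≤ k * max (G (Z i)) 0 * (ε / (2 * (Λ + 1))) := by
        gcongr; linarith
      exact this.trans (by gcongr)
    have h4 : Λ * (ε / (2 * (Λ + 1))) ≤ ε / 2 := by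
      rw [mul_div_assoc', div_le_div_iff₀ (by positivity) (by positivity)]
      nlinarith
    linarith

lemma deriv_le_of_right {g : ℝ → ℝ} {g' t c η : ℝ} (hη : 0 < η) (hg : HasDerivAt g g' t)
    (h : ∀ z ∈ Ioc t (t + η), g z - g t ≤ c * (z - t)) : g' ≤ c := by
  have h1 := (hasDerivWithinAt_iff_tendsto_slope' (s := Ioi t) (by simp)).1
    (hg.hasDerivWithinAt (s := Ioi t))
  refine le_of_tendsto h1 ?_
  filter_upwards [Ioc_mem_nhdsGT (show t < t + η by linarith)] with z hz
  have hz' : 0 < z - t := sub_pos.2 hz.1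
  rw [slope_def_field, div_le_iff₀ hz']
  exact h z hz

lemma pen_limit_deriv {Ω : Set (Pt m)} {ν : Pt m → Pt m} {G : Pt m → ℝ} (hG : GoodG Ω ν G)
    {F : Conf m n → Conf m n} (hF : Continuous F) {Λ : ℝ} (hΛ : 0 ≤ Λ) {T : ℝ}
    {κ : ℕ → ℝ} (hκ : ∀ j, 0 < κ j) {Xs : ℕ → ℝ → Conf m n} {X : ℝ → Conf m n}
    (hd : ∀ j, ∀ t ∈ Icc (0:ℝ) T, HasDerivWithinAt (Xs j) (penF F G (κ j) (Xs j t)) (Icc 0 T) t)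
    (hb : ∀ j, ∀ t ∈ Icc (0:ℝ) T, ∀ i, κ j * max (G (Xs j t i)) 0 ≤ Λ)
    (hu : TendstoUniformlyOn Xs X atTop (Icc 0 T)) (hXc : ContinuousOn X (Icc 0 T))
    {t : ℝ} (ht : t ∈ Ioo 0 T) (i : Fin n) {x' : Pt m} (hx : HasDerivAt (fun s => X s i) x' t)
    (v : Pt m) (hv : G (X t i) < 0 ∨ 0 ≤ ⟪gradient G (X t i), v⟫) :
    ⟪x', v⟫ ≤ ⟪F (X t) i, v⟫ := by
  refine le_of_forall_pos_le_add fun ε hε => ?_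
  obtain ⟨δ, hδ, hloc⟩ := pen_local hG hF hΛ (X t) i v hv hε
  have hXt : ContinuousAt X t := hXc.continuousAt (Icc_mem_nhds ht.1 ht.2)
  obtain ⟨η, hη, hηX⟩ := Metric.continuousAt_iff.1 hXt (δ / 2) (by positivity)
  have hTt : 0 < T - t := sub_pos.2 ht.2
  set ρ := min (η / 2) (T - t) with hρ
  have hρ0 : 0 < ρ := lt_min (by positivity) hTt
  have hρη : ρ ≤ η / 2 := min_le_left _ _
  have hρT : ρ ≤ T - t := min_le_right _ _
  have hg : HasDerivAt (fun s => ⟪X s i, v⟫) ⟪x', v⟫ t := by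
    have := hx.inner ℝ (hasDerivAt_const t v)
    simpa using this
  refine deriv_le_of_right hρ0 hg fun z hz => ?_
  have hzI : z ∈ Icc 0 T := ⟨by linarith [ht.1, hz.1], by linarith [hz.2]⟩
  have htI : t ∈ Icc 0 T := Ioo_subset_Icc_self ht
  have ev := Metric.tendstoUniformlyOn_iff.1 hu (δ / 2) (by positivity)
  have lim : Tendsto (fun j => ⟪Xs j z i, v⟫ - ⟪Xs j t i, v⟫) atTop
      (𝓝 (⟪X z i, v⟫ - ⟪X t i, v⟫)) := by
    have a1 := (tendsto_pi_nhds.1 (hu.tendsto_at hzI)) i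
    have a2 := (tendsto_pi_nhds.1 (hu.tendsto_at htI)) i
    exact (a1.inner tendsto_const_nhds).sub (a2.inner tendsto_const_nhds)
  refine le_of_tendsto lim ?_
  filter_upwards [ev] with j hj
  have hsub : Icc t z ⊆ Icc 0 T := Icc_subset_Icc ht.1.le hzI.2
  have hder : ∀ s ∈ Icc (0:ℝ) T, HasDerivWithinAt (fun s => ⟪Xs j s i, v⟫)
      ⟪penF F G (κ j) (Xs j s) i, v⟫ (Icc 0 T) s := fun s hs => by
    have := ((hasDerivWithinAt_pi.1 (hd j s hs)) i).inner ℝ (hasDerivWithinAt_const s _ v)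
    simpa using this
  have key := image_le_of_deriv_right_le_deriv_boundary (f := fun s => ⟪Xs j s i, v⟫)
    (f' := fun s => ⟪penF F G (κ j) (Xs j s) i, v⟫) (a := t) (b := z)
    (B := fun s => ⟪Xs j t i, v⟫ + (⟪F (X t) i, v⟫ + ε) * (s - t))
    (B' := fun _ => ⟪F (X t) i, v⟫ + ε)
    (fun s hs => ((hder s (hsub hs)).continuousWithinAt).mono hsub)
    (fun s hs => hasDerivWithinAt_Ici_of_Icc ⟨ht.1.le.trans hs.1, hs.2.trans_le hzI.2⟩
      (hder s (hsub (Ico_subset_Icc_self hs))))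
    (by simp)
    (by fun_prop)
    (fun s _ => by
      have := (((hasDerivAt_id s).sub_const t).const_mul (⟪F (X t) i, v⟫ + ε)).const_add
        ⟪Xs j t i, v⟫
      simpa using this.hasDerivWithinAt)
    (fun s hs => by
      have hs' := hsub (Ico_subset_Icc_self hs)
      refine hloc _ ?_ _ (hκ j) (hb j s hs' i)
      have d1 := hj s hs'
      have d2 : dist (X s) (X t) < δ / 2 := hηX (by
        rw [Real.dist_eq, abs_of_nonneg (by linarith [hs.1])]
        linarith [hs.2, hz.2])
      rw [dist_comm] at d1
      linarith [dist_triangle (Xs j s) (X s) (X t)])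
    (x := z) ⟨hz.1.le, le_rfl⟩
  linarith

lemma deriv_eq_proj {Ω : Set (Pt m)} {ν : Pt m → Pt m} {G : Pt m → ℝ} (hΩ : IsOpen Ω)
    (hG : GoodG Ω ν G) (hν : ∀ x ∈ frontier Ω, ‖ν x‖ = 1) {T : ℝ} {x : ℝ → Pt m}
    (hmem : ∀ t ∈ Icc (0:ℝ) T, x t ∈ closure Ω) {t : ℝ} (ht : t ∈ Ioo 0 T) {x' f : Pt m}
    (hx : HasDerivAt x x' t)
    (h : ∀ v, (G (x t) < 0 ∨ 0 ≤ ⟪gradient G (x t), v⟫) → ⟪x', v⟫ ≤ ⟪f, v⟫) :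
    x' = oneProj Ω ν (x t) f := by
  classical
  by_cases hxt : x t ∈ Ω
  · have h1 := h (x' - f) (Or.inl (hG.neg _ hxt))
    have h2 : ⟪x' - f, x' - f⟫ ≤ 0 := by
      rw [inner_sub_left]; linarith
    have h3 : x' - f = 0 := (real_inner_self_nonpos).1 h2
    have hnf : x t ∉ frontier Ω := by
      rw [hΩ.frontier_eq]; exact fun hh => hh.2 hxt
    rw [oneProj, if_neg (fun hh => hnf hh.1)]
    exact sub_eq_zero.1 h3
  · have hfr : x t ∈ frontier Ω := by
      rw [hΩ.frontier_eq]; exact ⟨hmem t (Ioo_subset_Icc_self ht), hxt⟩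
    rw [hG.grad _ hfr] at h
    have hν1 : ⟪ν (x t), ν (x t)⟫ = 1 := by
      rw [real_inner_self_eq_norm_sq, hν _ hfr]; norm_num
    have hmax : IsLocalMax (fun s => G (x s)) t := by
      filter_upwards [Ioo_mem_nhds ht.1 ht.2] with s hs
      rw [hG.zero _ hfr]
      exact hG.le_zero hΩ (hmem s (Ioo_subset_Icc_self hs))
    have hd : HasDerivAt (fun s => G (x s)) ⟪gradient G (x t), x'⟫ t := by
      rw [inner_grad_eq]
      exact (hG.diff (x t)).hasFDerivAt.comp_hasDerivAt t hx
    have h0 := hmax.hasDerivAt_eq_zero hd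
    rw [hG.grad _ hfr] at h0
    have h0' : ⟪x', ν (x t)⟫ = 0 := by rw [real_inner_comm]; exact h0
    have h1 := h (ν (x t)) (Or.inr (by rw [hν1]; norm_num))
    rw [h0'] at h1
    set a := ⟪f, ν (x t)⟫ with ha
    have ha' : ⟪ν (x t), f⟫ = a := by rw [real_inner_comm]
    set z := x' - f + a • ν (x t) with hz
    have hz0 : ⟪ν (x t), z⟫ = 0 := by
      rw [hz, inner_add_right, inner_sub_right, real_inner_smul_right, h0, hν1, ha']; ring
    have h2 := h z (Or.inr hz0.ge)
    have h3 : ⟪z, z⟫ ≤ 0 := by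
      have : ⟪z, z⟫ = ⟪x', z⟫ - ⟪f, z⟫ + a * ⟪ν (x t), z⟫ := by
        rw [← real_inner_smul_left, ← inner_sub_left, ← inner_add_left]
      rw [this, hz0]; linarith
    have h4 : z = 0 := (real_inner_self_nonpos).1 h3
    have h5 : x' = f - a • ν (x t) := by
      rw [hz] at h4
      rw [eq_sub_iff_add_eq, ← sub_eq_zero, ← h4]; abel
    rw [oneProj]
    split_ifs with hh
    · exact h5
    · have : a = 0 := le_antisymm (not_lt.1 fun hp => hh ⟨hfr, hp⟩) h1
      rw [h5, this]; simp

theorem exists_AESol {Ω : Set (Pt m)} {ν : Pt m → Pt m} {G : Pt m → ℝ} (hΩ : IsOpen Ω)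
    (hG : GoodG Ω ν G) (hν : ∀ x ∈ frontier Ω, ‖ν x‖ = 1)
    {F : Conf m n → Conf m n} {L : ℝ≥0} (hF : LipschitzWith L F) {M : ℝ} (hM : ∀ X, ‖F X‖ ≤ M)
    {T : ℝ} (hT : 0 ≤ T) {X0 : Conf m n} (hX0 : ∀ i, X0 i ∈ closure Ω) :
    ∃ X, AESol Ω ν F T X0 X := by
  obtain ⟨Λ, hΛ, k0, hk0, hbound⟩ := penF_bound hΩ hG hM T hX0
  obtain ⟨C, hC, hcauchy⟩ := penF_cauchy hG hF T hΛ
  set κ : ℕ → ℝ := fun j => k0 + j with hκdef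
  have hκ0 : ∀ j, k0 ≤ κ j := fun j => by simp [hκdef]
  have hκ : ∀ j, 0 < κ j := fun j => hk0.trans_le (hκ0 j)
  have hκt : Tendsto κ atTop atTop := tendsto_atTop_add_const_left _ _ tendsto_natCast_atTop_atTop
  choose Xs hXs0 hd using fun j => penF_exists hG hF hM hT X0 (hκ j).le
  have hb : ∀ j, ∀ t ∈ Icc (0:ℝ) T, ∀ i, κ j * max (G (Xs j t i)) 0 ≤ Λ := fun j =>
    hbound _ (hκ0 j) _ (hXs0 j) (hd j)
  have hc : ∀ j l, ∀ t ∈ Icc (0:ℝ) T, ‖Xs j t - Xs l t‖ ^ 2 ≤ C * (1 / κ j + 1 / κ l) :=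
    fun j l => hcauchy _ _ (hκ j) (hκ l) _ _ ((hXs0 j).trans (hXs0 l).symm) (hd j) (hd l)
      (hb j) (hb l)
  have hinv : Tendsto (fun j => 1 / κ j) atTop (𝓝 0) := by
    simp only [one_div]
    exact hκt.inv_tendsto_atTop
  have hUC : UniformCauchySeqOn Xs atTop (Icc 0 T) := by
    rw [Metric.uniformCauchySeqOn_iff]
    intro ε hε
    have : ∀ᶠ j in atTop, 1 / κ j < ε ^ 2 / (2 * (C + 1)) :=
      hinv.eventually_lt tendsto_const_nhds (by positivity)
    obtain ⟨N, hN⟩ := eventually_atTop.1 this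
    refine ⟨N, fun p hp q hq t ht => ?_⟩
    have h1 := hc p q t ht
    have h2 : C * (1 / κ p + 1 / κ q) < ε ^ 2 := by
      have e1 := hN p hp
      have e2 := hN q hq
      have e0 : 0 < 1 / κ p := one_div_pos.2 (hκ p)
      have e0' : 0 < 1 / κ q := one_div_pos.2 (hκ q)
      calc C * (1 / κ p + 1 / κ q) ≤ (C + 1) * (1 / κ p + 1 / κ q) := by gcongr; linarith
        _ < (C + 1) * (ε ^ 2 / (2 * (C + 1)) + ε ^ 2 / (2 * (C + 1))) := by gcongr
        _ = ε ^ 2 := by field_simp; norm_num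
    rw [dist_eq_norm]
    exact lt_of_pow_lt_pow_left₀ 2 hε.le (h1.trans_lt h2)
  have hlim : ∀ t : ℝ, ∃ x, t ∈ Icc 0 T → Tendsto (fun j => Xs j t) atTop (𝓝 x) := by
    intro t
    by_cases ht : t ∈ Icc 0 T
    · obtain ⟨x, hx⟩ := cauchySeq_tendsto_of_complete (hUC.cauchySeq ht)
      exact ⟨x, fun _ => hx⟩
    · exact ⟨0, fun h => (ht h).elim⟩
  choose X hX using hlim
  have hu : TendstoUniformlyOn Xs X atTop (Icc 0 T) :=
    hUC.tendstoUniformlyOn_of_tendsto fun t ht => hX t ht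
  obtain ⟨Cg, hCg⟩ := hG.bddGrad
  have hCg0 : 0 ≤ Cg := (norm_nonneg _).trans (hCg 0)
  have hM0 : 0 ≤ M := (norm_nonneg _).trans (hM 0)
  set R : ℝ≥0 := Real.toNNReal (M + Λ * Cg) with hR
  have hRc : (R : ℝ) = M + Λ * Cg := Real.coe_toNNReal _ (by positivity)
  have hpen : ∀ j, ∀ t ∈ Icc (0:ℝ) T, ‖penF F G (κ j) (Xs j t)‖ ≤ R := by
    intro j t ht
    refine (pi_norm_le_iff_of_nonneg (NNReal.coe_nonneg R)).2 fun i => ?_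
    refine (norm_sub_le _ _).trans ?_
    have h1 : ‖F (Xs j t) i‖ ≤ M := (norm_le_pi_norm _ i).trans (hM _)
    have h2 : ‖(κ j * max (G (Xs j t i)) 0) • gradient G (Xs j t i)‖ ≤ Λ * Cg := by
      have h0 : 0 ≤ κ j * max (G (Xs j t i)) 0 := mul_nonneg (hκ j).le (le_max_right _ _)
      rw [norm_smul, Real.norm_of_nonneg h0]
      exact mul_le_mul (hb j t ht i) (hCg _) (norm_nonneg _) hΛ
    rw [hRc]
    linarith
  have hlipj : ∀ j, LipschitzOnWith R (Xs j) (Icc 0 T) := fun j =>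
    (convex_Icc 0 T).lipschitzOnWith_of_nnnorm_hasDerivWithin_le (hd j) (hpen j)
  have hlip : LipschitzOnWith R X (Icc 0 T) := by
    refine LipschitzOnWith.of_dist_le_mul fun s hs t ht => ?_
    exact le_of_tendsto ((hX s hs).dist (hX t ht))
      (Eventually.of_forall fun j => (hlipj j).dist_le_mul s hs t ht)
  have hmem : ∀ t ∈ Icc (0:ℝ) T, ∀ i, X t i ∈ closure Ω := by
    intro t ht i
    by_contra hn
    have hpos := hG.pos _ hn
    have l1 : Tendsto (fun j => G (Xs j t i)) atTop (𝓝 (G (X t i))) :=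
      (hG.diff.continuous.tendsto _).comp ((tendsto_pi_nhds.1 (hX t ht)) i)
    have l2 : Tendsto (fun j => Λ * (1 / κ j)) atTop (𝓝 (Λ * 0)) := hinv.const_mul Λ
    have : G (X t i) ≤ Λ * 0 := le_of_tendsto_of_tendsto' l1 l2 fun j => by
      have h1 := hb j t ht i
      have h2 := le_max_left (G (Xs j t i)) 0
      rw [mul_one_div, le_div_iff₀ (hκ j)]
      nlinarith [hκ j]
    linarith
  refine ⟨X, ⟨R, hlip⟩, hmem, ?_, ?_⟩
  · have h0 := hX 0 ⟨le_rfl, hT⟩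
    simp only [hXs0] at h0
    exact tendsto_nhds_unique h0 tendsto_const_nhds
  · filter_upwards [hlip.ae_differentiableWithinAt_of_mem_real] with t htd ht i
    have htd := (htd (Ioo_subset_Icc_self ht)).differentiableAt (Icc_mem_nhds ht.1 ht.2)
    have hXi := hasDerivAt_pi.1 htd.hasDerivAt i
    have hlow : deriv X t i = oneProj Ω ν (X t i) (F (X t) i) :=
      deriv_eq_proj hΩ hG hν (x := fun s => X s i) (fun s hs => hmem s hs i) ht hXi fun v hv =>
      pen_limit_deriv hG hF.continuous hΛ hκ hd hb hu hlip.continuousOn ht i hXi v hv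
    rw [← hlow]
    exact hXi

open Classical in
/-- Saturated interaction potential. -/
def truncV (V : Pt m → ℝ) (B : ℝ) (x : Pt m) : ℝ := if x = 0 then 2 * B else satFn B (V x)

lemma truncV_contDiff {V : Pt m → ℝ} (hV : ContDiffOn ℝ 2 V {(0:Pt m)}ᶜ)
    (hVtop : Tendsto V (𝓝[≠] (0:Pt m)) atTop) {B : ℝ} (hB : 0 < B) :
    ContDiff ℝ 2 (truncV V B) := by
  classical
  refine contDiff_iff_contDiffAt.2 fun x => ?_
  by_cases hx : x = 0
  · subst hx
    have h1 : ∀ᶠ y in 𝓝 (0:Pt m), y ≠ 0 → 2 * B ≤ V y :=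
      eventually_nhdsWithin_iff.1 (hVtop.eventually_ge_atTop (2 * B))
    have h2 : truncV V B =ᶠ[𝓝 0] fun _ => 2 * B := by
      filter_upwards [h1] with y hy
      unfold truncV
      split_ifs with h
      · rfl
      · exact satFn_of_ge hB (hy h)
    exact contDiffAt_const.congr_of_eventuallyEq h2
  · have hn : {(0:Pt m)}ᶜ ∈ 𝓝 x := isOpen_compl_singleton.mem_nhds hx
    have h2 : truncV V B =ᶠ[𝓝 x] fun y => satFn B (V y) := by
      filter_upwards [hn] with y hy
      exact if_neg (fun h => hy h)
    exact ((contDiff_satFn B).contDiffAt.comp x (hV.contDiffAt hn)).congr_of_eventuallyEq h2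

lemma truncV_of_lt {V : Pt m → ℝ} {B : ℝ} (hB : 0 < B) {x : Pt m} (hx : x ≠ 0) (h : V x < B) :
    truncV V B x = V x := by
  rw [truncV, if_neg hx, satFn_of_le hB h.le]

lemma truncV_ge {V : Pt m → ℝ} {B : ℝ} (hB : 0 < B) {x : Pt m} (h : x = 0 ∨ B ≤ V x) :
    B ≤ truncV V B x := by
  unfold truncV
  split_ifs with hx
  · linarith
  · exact le_satFn hB (h.resolve_left hx)

lemma truncV_nonneg {V : Pt m → ℝ} (hVpos : ∀ x : Pt m, x ≠ 0 → 0 < V x) {B : ℝ} (hB : 0 < B)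
    (x : Pt m) : 0 ≤ truncV V B x := by
  by_cases h : x = 0 ∨ B ≤ V x
  · exact hB.le.trans (truncV_ge hB h)
  · push Not at h
    rw [truncV_of_lt hB h.1 h.2]
    exact (hVpos x h.1).le

lemma truncV_neg {V : Pt m → ℝ} (hVsym : ∀ x : Pt m, x ≠ 0 → V (-x) = V x) {B : ℝ}
    (x : Pt m) : truncV V B (-x) = truncV V B x := by
  by_cases h : x = 0
  · simp [h]
  · rw [truncV, truncV, if_neg h, if_neg (neg_ne_zero.2 h), hVsym x h]

lemma exists_cutoff {Ω : Set (Pt m)} (hb : Bornology.IsBounded Ω) {W : Pt m → ℝ}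
    (hW : ∀ x ∈ closure Ω, ContDiffAt ℝ 2 W x) :
    ∃ χ : Pt m → ℝ, ContDiff ℝ 2 χ ∧ HasCompactSupport χ ∧ (∀ᶠ x in 𝓝ˢ (closure Ω), χ x = 1) ∧
      ContDiff ℝ 2 (fun x => χ x * W x) := by
  have hc : IsCompact (closure Ω) := hb.isCompact_closure
  have hSo : IsOpen {x | ContDiffAt ℝ 2 W x} := by
    rw [isOpen_iff_mem_nhds]
    intro x hx
    exact ContDiffAt.eventually hx (by decide)
  obtain ⟨K, hK, h1, h2⟩ := exists_compact_between hc hSo hW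
  obtain ⟨f, hf1, hf0, -⟩ := exists_contMDiffMap_one_nhds_of_subset_interior (n := 2) (modelWithCornersSelf ℝ (Pt m))
    hc.isClosed h1
  have hfd : ContDiff ℝ 2 (f : Pt m → ℝ) := f.contMDiff.contDiff
  refine ⟨f, hfd, HasCompactSupport.intro hK hf0, hf1, contDiff_iff_contDiffAt.2 fun x => ?_⟩
  by_cases hx : x ∈ K
  · exact hfd.contDiffAt.mul (h2 hx)
  · have : (fun x => f x * W x) =ᶠ[𝓝 x] fun _ => 0 := by
      filter_upwards [hK.isClosed.isOpen_compl.mem_nhds hx] with y hy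
      rw [hf0 y hy, zero_mul]
    exact contDiffAt_const.congr_of_eventuallyEq this

/-- Truncated energy. -/
lemma exists_truncEnergy {Ω : Set (Pt m)} (hb : Bornology.IsBounded Ω) (hn : 2 ≤ n)
    {V : Pt m → ℝ} (hV : ContDiffOn ℝ 2 V {(0:Pt m)}ᶜ)
    (hVtop : Tendsto V (𝓝[≠] (0:Pt m)) atTop)
    (hVsym : ∀ x : Pt m, x ≠ 0 → V (-x) = V x)
    (hVpos : ∀ x : Pt m, x ≠ 0 → 0 < V x)
    {W : Pt m → ℝ} (hW : ∀ x ∈ closure Ω, ContDiffAt ℝ 2 W x)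
    (hW0 : ∀ x ∈ closure Ω, 0 ≤ W x) {B : ℝ} (hB : 0 < B) :
    ∃ U : Conf m n → ℝ, ContDiff ℝ 2 U ∧ HasCompactSupport U ∧
      (∀ X ∈ Gstar Ω n, (∀ i j, i ≠ j → V (X i - X j) < B) → U =ᶠ[𝓝 X] energy V W) ∧
      (∀ X : Conf m n, (∀ i, X i ∈ closure Ω) → U X < B / ((n:ℝ) * ((n:ℝ) - 1)) →
        X ∈ Gstar Ω n ∧ ∀ i j, i ≠ j → V (X i - X j) < B) := by
  classical
  obtain ⟨χ, hχ, hχc, hχ1, hχW⟩ := exists_cutoff hb hW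
  have hn1 : (0:ℝ) < (n:ℝ) * ((n:ℝ) - 1) := by
    have : (2:ℝ) ≤ n := by exact_mod_cast hn
    nlinarith
  have hn0 : (0:ℝ) < n := by
    have : (2:ℝ) ≤ n := by exact_mod_cast hn
    linarith
  have hTV := truncV_contDiff hV hVtop hB
  have hpi : ∀ i : Fin n, ContDiff ℝ 2 (fun X : Conf m n => X i) := fun i => contDiff_apply ℝ _ i
  refine ⟨fun X => (∏ i, χ (X i)) * energy (truncV V B) (fun x => χ x * W x) X, ?_, ?_, ?_, ?_⟩
  · refine ContDiff.mul (contDiff_prod fun i _ => hχ.comp (hpi i)) ?_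
    unfold energy
    refine ContDiff.add (contDiff_const.mul ?_) (contDiff_const.mul ?_)
    · exact ContDiff.sum fun i _ => ContDiff.sum fun j _ => hTV.comp ((hpi i).sub (hpi j))
    · exact ContDiff.sum fun i _ => hχW.comp (hpi i)
  · refine HasCompactSupport.intro (K := Set.pi univ fun _ => tsupport χ)
      (isCompact_univ_pi fun _ => hχc) fun X hX => ?_
    simp only [Set.mem_pi, mem_univ, true_imp_iff, not_forall] at hX
    obtain ⟨i, hi⟩ := hX
    rw [Finset.prod_eq_zero (Finset.mem_univ i) (image_eq_zero_of_notMem_tsupport (f := χ) (x := X i) hi),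
      zero_mul]
  · intro X hX hVX
    have e1 : ∀ᶠ Y in 𝓝 X, ∀ i, χ (Y i) = 1 := by
      refine eventually_all.2 fun i => ?_
      have := hχ1.filter_mono (nhds_le_nhdsSet (hX.1 i))
      exact (continuous_apply i).continuousAt.eventually this
    have e2 : ∀ᶠ Y in 𝓝 X, ∀ i j, i ≠ j → Y i - Y j ≠ 0 ∧ V (Y i - Y j) < B := by
      refine eventually_all.2 fun i => eventually_all.2 fun j => ?_
      by_cases hij : i = j
      · exact Eventually.of_forall fun Y h => (h hij).elim
      have hne : X i - X j ≠ 0 := sub_ne_zero.2 (hX.2 i j hij)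
      have hca : ContinuousAt (fun Y : Conf m n => Y i - Y j) X := by fun_prop
      have hVc : ContinuousAt V (X i - X j) :=
        (hV.contDiffAt (isOpen_compl_singleton.mem_nhds hne)).continuousAt
      have hVc' : ContinuousAt (fun Y : Conf m n => V (Y i - Y j)) X :=
        ContinuousAt.comp (g := V) hVc hca
      filter_upwards [hca.eventually_ne hne, hVc'.eventually_lt continuousAt_const (hVX i j hij)]
        with Y h1 h2 _ using ⟨h1, h2⟩
    filter_upwards [e1, e2] with Y h1 h2
    simp only [h1, Finset.prod_const_one, one_mul, energy]
    congr 2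
    refine Finset.sum_congr rfl fun i _ => Finset.sum_congr rfl fun j hj => ?_
    have hij : i ≠ j := ((Finset.mem_filter.1 hj).2).ne'
    exact truncV_of_lt hB (h2 i j hij).1 (h2 i j hij).2
  · intro X hX hU
    have h1 : ∀ i, χ (X i) = 1 := fun i => (hχ1.self_of_nhdsSet) (X i) (hX i)
    simp only [h1, Finset.prod_const_one, one_mul, energy] at hU
    have key : ∀ i j : Fin n, j < i → ¬ (X i - X j = 0 ∨ B ≤ V (X i - X j)) := by
      intro i j hij h
      have h2 := truncV_ge (V := V) hB h
      have h3 : truncV V B (X i - X j) ≤ ∑ i : Fin n,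
          ∑ j ∈ Finset.filter (fun j => j < i) Finset.univ, truncV V B (X i - X j) := by
        refine le_trans ?_ (Finset.single_le_sum (f := fun i : Fin n =>
          ∑ j ∈ Finset.filter (fun j => j < i) Finset.univ, truncV V B (X i - X j))
          (fun i _ => Finset.sum_nonneg fun j _ => truncV_nonneg hVpos hB _) (Finset.mem_univ i))
        exact Finset.single_le_sum (f := fun j => truncV V B (X i - X j))
          (fun j _ => truncV_nonneg hVpos hB _) (by simp [hij])
      have h4 : 0 ≤ ∑ i : Fin n, W (X i) := Finset.sum_nonneg fun i _ => hW0 _ (hX i)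
      have h5 : B / ((n:ℝ) * ((n:ℝ) - 1)) ≤ 1 / ((n:ℝ) * ((n:ℝ) - 1)) * ∑ i : Fin n,
          ∑ j ∈ Finset.filter (fun j => j < i) Finset.univ, truncV V B (X i - X j) := by
        rw [div_eq_mul_one_div, mul_comm]
        gcongr
        exact h2.trans h3
      have h6 : 0 ≤ 1 / (n:ℝ) * ∑ i : Fin n, W (X i) := by positivity
      linarith
    have key2 : ∀ i j : Fin n, i ≠ j → X i - X j ≠ 0 ∧ V (X i - X j) < B := by
      intro i j hij
      rcases lt_or_gt_of_ne hij with h | h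
      · have := key j i h
        push Not at this
        rw [← neg_sub (X j) (X i), hVsym _ this.1]
        exact ⟨neg_ne_zero.2 this.1, this.2⟩
      · have := key i j h
        push Not at this
        exact this
    exact ⟨⟨hX, fun i j hij => sub_ne_zero.1 (key2 i j hij).1⟩, fun i j hij => (key2 i j hij).2⟩

/-- Turn a differential into the negative gradient, componentwise. -/
def negGrad (A : Conf m n →L[ℝ] ℝ) : Conf m n := fun i =>
  -(InnerProductSpace.toDual ℝ (Pt m)).symm (A.comp (ContinuousLinearMap.single ℝ (fun _ => Pt m) i))

lemma negGrad_contDiff : ContDiff ℝ 1 (negGrad : (Conf m n →L[ℝ] ℝ) → Conf m n) := by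
  refine contDiff_pi.2 fun i => ContDiff.neg ?_
  refine (InnerProductSpace.toDual ℝ (Pt m)).symm.toContinuousLinearEquiv.contDiff.comp ?_
  exact contDiff_id.clm_comp contDiff_const

lemma negGrad_zero : negGrad (0 : Conf m n →L[ℝ] ℝ) = 0 := by
  funext i; simp [negGrad]

lemma inner_negGrad (A : Conf m n →L[ℝ] ℝ) (Y : Conf m n) :
    A Y = -∑ i, ⟪negGrad A i, Y i⟫ := by
  have h : ∀ i, ⟪negGrad A i, Y i⟫ = -A (Pi.single i (Y i)) := by
    intro i
    simp [negGrad, inner_neg_left]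
  simp only [h, Finset.sum_neg_distrib, neg_neg]
  rw [← map_sum, Finset.univ_sum_single]

/-- The force field of an energy. -/
def forceOf (U : Conf m n → ℝ) (X : Conf m n) : Conf m n := negGrad (fderiv ℝ U X)

lemma forceOf_good {U : Conf m n → ℝ} (hU : ContDiff ℝ 2 U) (hc : HasCompactSupport U) :
    (∃ L : ℝ≥0, LipschitzWith L (forceOf U)) ∧ ∃ M : ℝ, ∀ X, ‖forceOf U X‖ ≤ M := by
  have h1 : ContDiff ℝ 1 (forceOf U) := negGrad_contDiff.comp (hU.fderiv_right (by norm_num))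
  have h2 : HasCompactSupport (forceOf U) := (hc.fderiv ℝ).comp_left negGrad_zero
  exact ⟨ContDiff.lipschitzWith_of_hasCompactSupport h2 h1 (by norm_num),
    h2.exists_bound_of_continuous h1.continuous⟩

lemma forceOf_eq {U : Conf m n → ℝ} (hU : ContDiff ℝ 2 U) {V W : Pt m → ℝ} {X : Conf m n}
    (h : U =ᶠ[𝓝 X] energy V W) (i : Fin n) : forceOf U X i = -Egrad V W i X := by
  have hc : ContinuousAt (fun y => Function.update X i y) (X i) :=
    (continuous_const.update i continuous_id).continuousAt
  have hup : Function.update X i (X i) = X := Function.update_eq_self i X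
  have h1 : (fun y => energy V W (Function.update X i y)) =ᶠ[𝓝 (X i)]
      fun y => U (Function.update X i y) := by
    have h' : ∀ᶠ Z in 𝓝 (Function.update X i (X i)), energy V W Z = U Z := by
      rw [hup]
      exact h.symm
    exact hc.eventually h'
  have hd : HasFDerivAt (fun y => U (Function.update X i y))
      ((fderiv ℝ U X).comp (ContinuousLinearMap.single ℝ (fun _ => Pt m) i)) (X i) := by
    have a1 : HasFDerivAt U (fderiv ℝ U X) (Function.update X i (X i)) := by
      rw [hup]
      exact (hU.differentiable (by norm_num) X).hasFDerivAt
    have a2 := a1.comp (X i) (hasFDerivAt_update (𝕜 := ℝ) X (X i))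
    have a3 : ContinuousLinearMap.pi (Pi.single i (ContinuousLinearMap.id ℝ (Pt m)))
        = ContinuousLinearMap.single ℝ (fun _ : Fin n => Pt m) i := by
      refine ContinuousLinearMap.ext fun y => funext fun j => ?_
      by_cases hj : j = i
      · subst hj; simp
      · simp [hj]
    rw [a3] at a2
    exact a2
  rw [forceOf, negGrad, Egrad, gradient, h1.fderiv_eq, hd.fderiv]

lemma energy_decay_s19 {Ω : Set (Pt m)} {ν : Pt m → Pt m} (hν : ∀ x ∈ frontier Ω, ‖ν x‖ = 1)
    {U : Conf m n → ℝ} (hU : ContDiff ℝ 2 U) {T : ℝ} {X0 : Conf m n} {X : ℝ → Conf m n}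
    (hX : AESol Ω ν (forceOf U) T X0 X) : ∀ t ∈ Icc (0:ℝ) T, U (X t) ≤ U X0 := by
  obtain ⟨K, hK⟩ := hX.lip
  obtain ⟨K', hK'⟩ := lip_comp (hU.of_le (by norm_num)) hK
  intro t ht
  have := le_of_ae_deriv_nonpos hK' (by
    filter_upwards [hX.deriv] with s hs hsI
    have h1 : HasDerivAt X (fun i => oneProj Ω ν (X s i) (forceOf U (X s) i)) s :=
      hasDerivAt_pi.2 (hs hsI)
    refine ⟨_, ?_, (hU.differentiable (by norm_num) (X s)).hasFDerivAt.comp_hasDerivAt s h1⟩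
    rw [inner_negGrad, neg_nonpos]
    refine Finset.sum_nonneg fun i _ => ?_
    have h2 := inner_oneProj hν (X s i) (forceOf U (X s) i)
    rw [show negGrad (fderiv ℝ U (X s)) = forceOf U (X s) from rfl, h2]
    positivity) t ht
  rw [hX.init] at this
  exact this

lemma isMildSol_congr {Ω : Set (Pt m)} {ν : Pt m → Pt m} {F F' : Fin n → ℝ → Conf m n → Pt m}
    {T : ℝ} {X0 : Conf m n} {X : ℝ → Conf m n} (h : IsMildSol Ω ν F T X0 X)
    (hF : ∀ t ∈ Icc (0:ℝ) T, ∀ i, F i t (X t) = F' i t (X t)) : IsMildSol Ω ν F' T X0 X := by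
  refine ⟨h.1, h.2.1, fun t ht i => ?_⟩
  rw [h.2.2 t ht i]
  congr 1
  refine intervalIntegral.integral_congr fun s hs => ?_
  rw [uIcc_of_le ht.1] at hs
  simp only [hF s ⟨hs.1, hs.2.trans ht.2⟩ i]

/-- Pair potentials are bounded along continuous curves in `Gstar`. -/
lemma exists_pair_bound {Ω : Set (Pt m)} {V : Pt m → ℝ} (hV : ContDiffOn ℝ 2 V {(0:Pt m)}ᶜ) {T : ℝ}
    {X : ℝ → Conf m n} (hXc : ∀ i, ContinuousOn (fun t => X t i) (Icc 0 T))
    (hX : ∀ t ∈ Icc (0:ℝ) T, X t ∈ Gstar Ω n) :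
    ∃ B0 : ℝ, ∀ t ∈ Icc (0:ℝ) T, ∀ i j, i ≠ j → V (X t i - X t j) < B0 := by
  have h : ∀ p : Fin n × Fin n, ∃ C : ℝ, ∀ t ∈ Icc (0:ℝ) T, p.1 ≠ p.2 →
      V (X t p.1 - X t p.2) ≤ C := by
    rintro ⟨i, j⟩
    by_cases hij : i = j
    · exact ⟨0, fun t _ h => (h hij).elim⟩
    have hc : ContinuousOn (fun t => V (X t i - X t j)) (Icc 0 T) :=
      hV.continuousOn.comp ((hXc i).sub (hXc j)) fun t ht => sub_ne_zero.2 ((hX t ht).2 i j hij)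
    obtain ⟨C, hC⟩ := isCompact_Icc.bddAbove_image hc
    exact ⟨C, fun t ht _ => hC ⟨t, ht, rfl⟩⟩
  choose C hC using h
  refine ⟨∑ p, |C p| + 1, fun t ht i j hij => ?_⟩
  have h1 := hC (i, j) t ht hij
  have h2 : |C (i, j)| ≤ ∑ p, |C p| :=
    Finset.single_le_sum (f := fun p => |C p|) (fun _ _ => abs_nonneg _) (Finset.mem_univ (i, j))
  have h3 := le_abs_self (C (i, j))
  simp only at h1
  linarith

/-- **Theorem (well-posedness of the confined gradient flow).**
For every `T > 0` and `X° ∈ G_*` the confined gradient flow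
`ẋ_i = P(x_i, −∇_{x_i}E(X))`, `X(0) = X°`, has a unique mild solution, which
stays in `G_*` for all `t ∈ [0,T]`. -/
theorem gradient_flow_wellposed {m n : ℕ} (Ω : Set (Pt m)) (ν : Pt m → Pt m)
    (hΩ : IsC2Domain Ω ν) (hn : 2 ≤ n)
    (V : Pt m → ℝ) (hV : ContDiffOn ℝ 2 V {(0:Pt m)}ᶜ)
    (hVtop : Tendsto V (𝓝[≠] (0:Pt m)) atTop)
    (hVsym : ∀ x : Pt m, x ≠ 0 → V (-x) = V x)
    (hVpos : ∀ x : Pt m, x ≠ 0 → 0 < V x)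
    (W : Pt m → ℝ) (hW : ∀ x ∈ closure Ω, ContDiffAt ℝ 2 W x)
    (hW0 : ∀ x ∈ closure Ω, 0 ≤ W x)
    (T : ℝ) (hT : 0 < T) (X0 : Conf m n) (hX0 : X0 ∈ Gstar Ω n) :
    ∃ X : ℝ → Conf m n,
      (IsMildSol Ω ν (fun i _ Y => -Egrad V W i Y) T X0 X ∧
        ∀ t ∈ Icc (0:ℝ) T, X t ∈ Gstar Ω n) ∧
      ∀ Y : ℝ → Conf m n,
        IsMildSol Ω ν (fun i _ Y' => -Egrad V W i Y') T X0 Y →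
        (∀ t ∈ Icc (0:ℝ) T, Y t ∈ Gstar Ω n) →
        ∀ t ∈ Icc (0:ℝ) T, Y t = X t := by
  have hne : X0 ⟨0, by omega⟩ ≠ X0 ⟨1, by omega⟩ := hX0.2 _ _ (by simp)
  have hnt : Nontrivial (Pt m) := ⟨⟨_, _, hne⟩⟩
  obtain ⟨G, hG⟩ := exists_goodG hΩ
  have hν := hΩ.normal_unit
  have hn1 : (0:ℝ) < (n:ℝ) * ((n:ℝ) - 1) := by
    have : (2:ℝ) ≤ n := by exact_mod_cast hn
    nlinarith
  -- existence
  have hex : ∃ X : ℝ → Conf m n, IsMildSol Ω ν (fun i _ Y => -Egrad V W i Y) T X0 X ∧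
      ∀ t ∈ Icc (0:ℝ) T, X t ∈ Gstar Ω n := by
    obtain ⟨B0, hB0⟩ := exists_pair_bound (Ω := Ω) (n := n) hV (T := 0) (X := fun _ => X0)
      (fun i => continuousOn_const) (fun _ _ => hX0)
    have hB0' := hB0 0 ⟨le_rfl, le_rfl⟩
    set B : ℝ := |B0| + |(n:ℝ) * ((n:ℝ) - 1) * energy V W X0| + 1 with hBdef
    have hB : 0 < B := by positivity
    obtain ⟨U, hU, hUc, hUa, hUb⟩ := exists_truncEnergy (n := n) hΩ.bounded hn hV hVtop hVsym hVpos
      hW hW0 hB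
    obtain ⟨⟨L, hL⟩, M, hM⟩ := forceOf_good hU hUc
    obtain ⟨X, hX⟩ := exists_AESol hΩ.isOpen hG hν hL hM hT.le hX0.1
    have hVX0 : ∀ i j, i ≠ j → V (X0 i - X0 j) < B := fun i j hij => by
      have := hB0' i j hij
      have h1 := le_abs_self B0
      have h2 := abs_nonneg ((n:ℝ) * ((n:ℝ) - 1) * energy V W X0)
      linarith
    have hU0 : U X0 = energy V W X0 := (hUa X0 hX0 hVX0).eq_of_nhds
    have hlt : U X0 < B / ((n:ℝ) * ((n:ℝ) - 1)) := by
      rw [hU0, lt_div_iff₀ hn1, mul_comm]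
      have h1 := abs_nonneg B0
      have h2 := le_abs_self ((n:ℝ) * ((n:ℝ) - 1) * energy V W X0)
      rw [hBdef]
      linarith
    have hstay : ∀ t ∈ Icc (0:ℝ) T, X t ∈ Gstar Ω n ∧ ∀ i j, i ≠ j → V (X t i - X t j) < B :=
      fun t ht => hUb _ (hX.mem t ht) ((energy_decay_s19 hν hU hX t ht).trans_lt hlt)
    refine ⟨X, ?_, fun t ht => (hstay t ht).1⟩
    refine isMildSol_congr (hX.isMildSol hG hν hL.continuous hM hT.le) fun t ht i => ?_
    exact forceOf_eq hU (hUa _ (hstay t ht).1 (hstay t ht).2) i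
  obtain ⟨X, hX, hXs⟩ := hex
  refine ⟨X, ⟨hX, hXs⟩, fun Y hY hYs => ?_⟩
  obtain ⟨B1, hB1⟩ := exists_pair_bound hV hX.1 hXs
  obtain ⟨B2, hB2⟩ := exists_pair_bound hV hY.1 hYs
  set B : ℝ := |B1| + |B2| + 1 with hBdef
  have hB : 0 < B := by positivity
  obtain ⟨U, hU, hUc, hUa, -⟩ := exists_truncEnergy (n := n) hΩ.bounded hn hV hVtop hVsym hVpos
    hW hW0 hB
  obtain ⟨⟨L, hL⟩, M, hM⟩ := forceOf_good hU hUc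
  have hX' : IsMildSol Ω ν (fun i _ Z => forceOf U Z i) T X0 X :=
    isMildSol_congr hX fun t ht i => (forceOf_eq hU (hUa _ (hXs t ht) fun i j hij => by
      have := hB1 t ht i j hij
      have h1 := le_abs_self B1
      have h2 := abs_nonneg B2
      linarith) i).symm
  have hY' : IsMildSol Ω ν (fun i _ Z => forceOf U Z i) T X0 Y :=
    isMildSol_congr hY fun t ht i => (forceOf_eq hU (hUa _ (hYs t ht) fun i j hij => by
      have := hB2 t ht i j hij
      have h1 := le_abs_self B2
      have h2 := abs_nonneg B1
      linarith) i).symm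
  exact AESol.unique hΩ.isOpen hG hν hL hM
    (aeSol_of_isMildSol hG hν hL.continuous hM hT.le hX')
    (aeSol_of_isMildSol hG hν hL.continuous hM hT.le hY')
end
end
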